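/- Let d ≥ 2, s ∈ (0,1), p > 1, q ≥ 1, τ ≥ 1, 0 < a ≤ 1, α, β, γ ∈ ℝ, Λ > 1, and define σ by γ = aσ + (1−a)β. Assume the balance law 1/τ + γ/d = a(1/p + (α−s)/d) + (1−a)(1/q + β/d), that −(d−1)s ≤ α − σ < 0, and that 1/τ + γ/d > 0. Then there exists C > 0 such that for every radial u ∈ L¹_loc(ℝ^d \ {0}) with compact support in ℝ^d, ‖|x|^γ u‖_{L^τ(ℝ^d)} ≤ C ‖u‖_{Ẇ^{s,p,α,Λ}(ℝ^d)}^a ‖|x|^β u‖_{L^q(ℝ^d)}^{1−a}. -/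

import Mathlib

open MeasureTheory ENNReal Set

/-- The cutoff `χ_Λ(r₁, r₂)`, equal to `1` when `Λ⁻¹ r₁ ≤ r₂ ≤ Λ r₁` and `0` otherwise. -/
noncomputable def chiCut (Λ r₁ r₂ : ℝ) : ℝ :=
  if Λ⁻¹ * r₁ ≤ r₂ ∧ r₂ ≤ Λ * r₁ then 1 else 0

/-- The truncated weighted Gagliardo seminorm `‖g‖_{Ẇ^{s,p,α,Λ}(ℝ^d)}`. -/
noncomputable def truncGagliardo (d : ℕ) (s p α Λ : ℝ)
    (g : EuclideanSpace ℝ (Fin d) → ℝ) : ℝ≥0∞ :=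
  (∫⁻ x : EuclideanSpace ℝ (Fin d), ∫⁻ y : EuclideanSpace ℝ (Fin d),
      ENNReal.ofReal (|g x - g y| ^ p * ‖x‖ ^ (α * p) *
        chiCut Λ ‖x‖ ‖y‖ / ‖x - y‖ ^ ((d : ℝ) + s * p))) ^ (1 / p)

/-- The weighted norm `‖ |x|^γ v ‖_{L^τ(ℝ^d)}`, valued in `[0,∞]`. -/
noncomputable def weightedLnorm (d : ℕ) (γ τ : ℝ)
    (v : EuclideanSpace ℝ (Fin d) → ℝ) : ℝ≥0∞ :=
  (∫⁻ x : EuclideanSpace ℝ (Fin d), ENNReal.ofReal (‖x‖ ^ (γ * τ) * |v x| ^ τ)) ^ (1 / τ)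


lemma ckn_hold {X : Type*} [MeasurableSpace X] (μ : Measure X) {F : X → ℝ≥0∞}
    (hF : AEMeasurable F μ) {p : ℝ} (hp : 1 ≤ p) :
    ∫⁻ x, F x ∂μ ≤ (μ univ) ^ (1 - 1 / p) * (∫⁻ x, F x ^ p ∂μ) ^ (1 / p) := by
  have h0 : 0 < p := by linarith
  have h := ENNReal.lintegral_mul_norm_pow_le (μ := μ) (f := fun _ => (1 : ℝ≥0∞))
    (g := fun x => F x ^ p) aemeasurable_const (hF.pow_const p) (p := 1 - 1 / p) (q := 1 / p)
    (by rw [sub_nonneg, div_le_one h0]; exact hp) (by positivity) (by ring)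
  simp only [ENNReal.one_rpow, one_mul, lintegral_const] at h
  refine le_trans (le_of_eq ?_) h
  congr 1; ext x
  rw [← ENNReal.rpow_mul, mul_one_div_cancel h0.ne', ENNReal.rpow_one]

/-- local Gagliardo density -/
noncomputable def cknG (s p : ℝ) (f : ℝ → ℝ) (B : Set ℝ) (x : ℝ) : ℝ≥0∞ :=
  ∫⁻ y in B, ‖f x - f y‖ₑ ^ p / ENNReal.ofReal (|x - y| ^ (1 + s * p))

lemma cknG_measurable (s p : ℝ) {f : ℝ → ℝ} (hf : Measurable f) (B : Set ℝ) :
    Measurable (cknG s p f B) := by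
  unfold cknG
  apply Measurable.lintegral_prod_right' (f := fun z : ℝ × ℝ => ‖f z.1 - f z.2‖ₑ ^ p / ENNReal.ofReal (|z.1 - z.2| ^ (1 + s * p)))
  fun_prop

lemma ckn_avg {s p : ℝ} (hs : 0 < s) (hp : 1 < p) {f : ℝ → ℝ} (hf : Measurable f) {B : Set ℝ}
    {x e ρ : ℝ} (hρ : 0 < ρ) (hJ : Ioc e (e + ρ) ⊆ B) (hx : ∀ y ∈ Ioc e (e + ρ), |x - y| ≤ ρ) :
    ∫⁻ y in Ioc e (e + ρ), ‖f x - f y‖ₑ ≤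
      ENNReal.ofReal (ρ ^ (1 + s)) * (cknG s p f B x) ^ (1 / p) := by
  have h0 : 0 < p := by linarith
  have hsp : 0 < s * p := by positivity
  have h1 := ckn_hold (volume.restrict (Ioc e (e + ρ))) (F := fun y => ‖f x - f y‖ₑ)
    (by fun_prop) hp.le
  refine h1.trans ?_
  have h2 : ∫⁻ y in Ioc e (e + ρ), ‖f x - f y‖ₑ ^ p ≤
      ENNReal.ofReal (ρ ^ (1 + s * p)) * cknG s p f B x := by
    unfold cknG
    rw [← lintegral_const_mul _ (by fun_prop)]
    refine le_trans ?_ (lintegral_mono_set hJ)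
    refine setLIntegral_mono (by fun_prop) ?_
    intro y hy
    by_cases hxy : x = y
    · subst hxy; simp [h0]
    have hpos : 0 < |x - y| := abs_pos.mpr (sub_ne_zero.mpr hxy)
    have hk : ENNReal.ofReal (|x - y| ^ (1 + s * p)) ≤ ENNReal.ofReal (ρ ^ (1 + s * p)) :=
      ENNReal.ofReal_le_ofReal (Real.rpow_le_rpow hpos.le (hx y hy) (by positivity))
    have hk0 : ENNReal.ofReal (|x - y| ^ (1 + s * p)) ≠ 0 := by
      simp only [ne_eq, ENNReal.ofReal_eq_zero, not_le]; positivity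
    calc ‖f x - f y‖ₑ ^ p = ENNReal.ofReal (|x - y| ^ (1 + s * p)) *
          (‖f x - f y‖ₑ ^ p / ENNReal.ofReal (|x - y| ^ (1 + s * p))) := by
            rw [ENNReal.mul_div_cancel hk0 ENNReal.ofReal_ne_top]
      _ ≤ _ := by gcongr
  have h3 : (volume.restrict (Ioc e (e + ρ))) univ = ENNReal.ofReal ρ := by simp
  rw [h3]
  calc ENNReal.ofReal ρ ^ (1 - 1 / p) * (∫⁻ y in Ioc e (e + ρ), ‖f x - f y‖ₑ ^ p) ^ (1 / p)
      ≤ ENNReal.ofReal ρ ^ (1 - 1 / p) * (ENNReal.ofReal (ρ ^ (1 + s * p)) * cknG s p f B x) ^ (1 / p) := by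
        gcongr
    _ = _ := by
        rw [ENNReal.mul_rpow_of_nonneg _ _ (by positivity), ← mul_assoc,
          ENNReal.ofReal_rpow_of_pos hρ, ENNReal.ofReal_rpow_of_pos (by positivity),
          ← ENNReal.ofReal_mul (by positivity), ← Real.rpow_mul hρ.le, ← Real.rpow_add hρ]
        congr 3
        field_simp; ring

lemma ckn_two {s p T : ℝ} (hs : 0 < s) (hp : 1 < p) (hT : 1 ≤ T) {f : ℝ → ℝ} (hf : Measurable f)
    {b L x ρ c : ℝ} (hρ : 0 < ρ) (hρL : ρ ≤ L) (hx : x ∈ Ioc b (b + L)) :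
    ‖f x - c‖ₑ ≤ ENNReal.ofReal (ρ ^ s) * (cknG s p f (Ioc b (b + L)) x) ^ (1 / p) +
      ENNReal.ofReal (ρ ^ (-(1 / T))) * (∫⁻ y in Ioc b (b + L), ‖f y - c‖ₑ ^ T) ^ (1 / T) := by
  set e := min x (b + L - ρ) with he
  have hJ : Ioc e (e + ρ) ⊆ Ioc b (b + L) := by
    apply Ioc_subset_Ioc
    · exact le_min hx.1.le (by linarith)
    · have := min_le_right x (b + L - ρ); linarith
  have hex : e ≤ x := min_le_left _ _
  have hxe : x ≤ e + ρ := by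
    rcases min_cases x (b + L - ρ) with h | h
    · rw [he, h.1]; linarith
    · rw [he, h.1]; linarith [hx.2]
  have hd : ∀ y ∈ Ioc e (e + ρ), |x - y| ≤ ρ := by
    intro y hy; rw [abs_le]; constructor <;> linarith [hy.1, hy.2]
  have hT0 : 0 < T := by linarith
  have h1 := ckn_avg (s := s) (p := p) hs hp hf hρ hJ hd
  have h2 := ckn_hold (volume.restrict (Ioc e (e + ρ))) (F := fun y => ‖f y - c‖ₑ)
    (by fun_prop) hT
  have h3 : (volume.restrict (Ioc e (e + ρ))) univ = ENNReal.ofReal ρ := by simp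
  rw [h3] at h2
  have h4 : ENNReal.ofReal ρ * ‖f x - c‖ₑ ≤
      (∫⁻ y in Ioc e (e + ρ), ‖f x - f y‖ₑ) + ∫⁻ y in Ioc e (e + ρ), ‖f y - c‖ₑ := by
    rw [← lintegral_add_left (by fun_prop)]
    calc ENNReal.ofReal ρ * ‖f x - c‖ₑ = ∫⁻ y in Ioc e (e + ρ), ‖f x - c‖ₑ := by
          rw [lintegral_const, h3, mul_comm]
      _ ≤ _ := by
          apply lintegral_mono
          intro y
          have : f x - c = (f x - f y) + (f y - c) := by ring
          rw [this]; exact enorm_add_le _ _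
  have h5 : (∫⁻ y in Ioc e (e + ρ), ‖f y - c‖ₑ ^ T) ≤ (∫⁻ y in Ioc b (b + L), ‖f y - c‖ₑ ^ T) :=
    lintegral_mono_set hJ
  have hr0 : ENNReal.ofReal ρ ≠ 0 := by simpa using hρ
  rw [← ENNReal.mul_le_mul_iff_right hr0 ENNReal.ofReal_ne_top]
  refine h4.trans ?_
  rw [mul_add]
  gcongr ?_ + ?_
  · refine h1.trans (le_of_eq ?_)
    rw [← mul_assoc, ← ENNReal.ofReal_mul hρ.le, Real.rpow_add hρ, Real.rpow_one]
  · refine h2.trans ?_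
    rw [← mul_assoc, ← ENNReal.ofReal_mul hρ.le, ENNReal.ofReal_rpow_of_pos hρ, sub_eq_add_neg,
      Real.rpow_add hρ, Real.rpow_one]
    gcongr

lemma ckn_mean {s p : ℝ} (hs : 0 < s) (hp : 1 < p) {f : ℝ → ℝ} (hf : Measurable f)
    {M : ℝ} (hM : ∀ x, |f x| ≤ M) {b L x : ℝ} (hL : 0 < L) (hx : x ∈ Ioc b (b + L)) :
    ‖f x - (⨍ y in Ioc b (b + L), f y)‖ₑ ≤
      ENNReal.ofReal (L ^ s) * (cknG s p f (Ioc b (b + L)) x) ^ (1 / p) := by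
  have hd : ∀ y ∈ Ioc b (b + L), |x - y| ≤ L := by
    intro y hy; rw [abs_le]; constructor <;> linarith [hy.1, hy.2, hx.1, hx.2]
  have h1 := ckn_avg (s := s) (p := p) hs hp hf hL (Subset.refl _) hd
  have h3 : (volume.restrict (Ioc b (b + L))) univ = ENNReal.ofReal L := by simp
  have hr0 : ENNReal.ofReal L ≠ 0 := by simpa using hL
  have hint : Integrable f (volume.restrict (Ioc b (b + L))) :=
    Integrable.of_bound hf.aestronglyMeasurable M (Filter.Eventually.of_forall hM)
  have h6 : L * (f x - (⨍ y in Ioc b (b + L), f y)) = ∫ y in Ioc b (b + L), (f x - f y) := by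
    rw [integral_sub (integrable_const _) hint, setAverage_eq, integral_const]
    simp [Measure.real, hL.le]
    field_simp
  rw [← ENNReal.mul_le_mul_iff_right hr0 ENNReal.ofReal_ne_top]
  calc ENNReal.ofReal L * ‖f x - (⨍ y in Ioc b (b + L), f y)‖ₑ
      = ‖L * (f x - (⨍ y in Ioc b (b + L), f y))‖ₑ := by
        rw [enorm_mul, Real.enorm_of_nonneg hL.le]
    _ ≤ _ := by rw [h6]; exact enorm_integral_le_lintegral_enorm _
    _ ≤ _ := h1
    _ = _ := by
      rw [← mul_assoc, ← ENNReal.ofReal_mul hL.le, Real.rpow_add hL, Real.rpow_one]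

lemma ckn_opt {s T L : ℝ} (hs : 0 < s) (hT : 1 ≤ T) (hL : 0 < L) {H g N : ℝ≥0∞}
    (hN0 : N ≠ 0) (hNt : N ≠ ⊤)
    (h1 : ∀ ρ : ℝ, 0 < ρ → ρ ≤ L → H ≤ ENNReal.ofReal (ρ ^ s) * g + ENNReal.ofReal (ρ ^ (-(1 / T))) * N)
    (h2 : H ≤ ENNReal.ofReal (L ^ s) * g) :
    H ≤ 2 * (g ^ (1 / (1 + T * s)) * N ^ (1 - 1 / (1 + T * s))) := by
  have hT0 : 0 < T := by linarith
  have hTs : 0 < T * s := by positivity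
  by_cases hg0 : g = 0
  · subst hg0; simp at h2; simp [h2]
  by_cases hgt : g = ⊤
  · subst hgt
    rw [ENNReal.top_rpow_of_pos (by positivity), ENNReal.top_mul]
    · simp
    · rw [ne_eq, ENNReal.rpow_eq_zero_iff]; simp [hN0, hNt]
  obtain ⟨g', rfl⟩ : ∃ g' : ℝ, g = ENNReal.ofReal g' := ⟨g.toReal, (ENNReal.ofReal_toReal hgt).symm⟩
  obtain ⟨n, rfl⟩ : ∃ n : ℝ, N = ENNReal.ofReal n := ⟨N.toReal, (ENNReal.ofReal_toReal hNt).symm⟩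
  have hg : 0 < g' := by simpa using hg0
  have hn : 0 < n := by simpa using hN0
  set θ := 1 / (1 + T * s) with hθ
  set r := (n / g') ^ (T / (1 + T * s)) with hr
  have hr0 : 0 < r := by positivity
  have e1 : r ^ s * g' = g' ^ θ * n ^ (1 - θ) := by
    rw [hr, ← Real.rpow_mul (by positivity), Real.div_rpow hn.le hg.le]
    have : T / (1 + T * s) * s = 1 - θ := by rw [hθ]; field_simp; ring
    rw [this, div_mul_eq_mul_div, div_eq_iff (by positivity), mul_right_comm, ← Real.rpow_add hg]
    simp [mul_comm]
  have e2 : r ^ (-(1 / T)) * n = g' ^ θ * n ^ (1 - θ) := by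
    rw [hr, ← Real.rpow_mul (by positivity)]
    have : T / (1 + T * s) * -(1 / T) = -θ := by rw [hθ]; field_simp
    rw [this, Real.rpow_neg (by positivity), Real.div_rpow hn.le hg.le, Real.rpow_sub hn, Real.rpow_one]
    field_simp
  have e3 : (2 : ℝ≥0∞) * (ENNReal.ofReal g' ^ θ * ENNReal.ofReal n ^ (1 - θ)) =
      ENNReal.ofReal (g' ^ θ * n ^ (1 - θ)) + ENNReal.ofReal (g' ^ θ * n ^ (1 - θ)) := by
    rw [ENNReal.ofReal_rpow_of_pos hg, ENNReal.ofReal_rpow_of_pos hn, ← ENNReal.ofReal_mul (by positivity), two_mul]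
  rw [e3]
  by_cases hrL : r ≤ L
  · refine (h1 r hr0 hrL).trans (le_of_eq ?_)
    rw [← ENNReal.ofReal_mul (by positivity), ← ENNReal.ofReal_mul (by positivity), e1, e2]
  · refine h2.trans (le_trans ?_ le_self_add)
    rw [← ENNReal.ofReal_mul (by positivity), ← e1]
    apply ENNReal.ofReal_le_ofReal
    gcongr
    linarith

lemma ckn_hold3 {X : Type*} [MeasurableSpace X] (μ : Measure X) {F G : X → ℝ≥0∞}
    (hF : AEMeasurable F μ) (hG : AEMeasurable G μ) {u v : ℝ} (hu : 0 ≤ u) (hv : 0 ≤ v)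
    (huv : u + v ≤ 1) :
    ∫⁻ x, F x ^ u * G x ^ v ∂μ ≤
      (μ univ) ^ (1 - u - v) * ((∫⁻ x, F x ∂μ) ^ u * (∫⁻ x, G x ∂μ) ^ v) := by
  have h := ENNReal.lintegral_prod_norm_pow_le (μ := μ) (Finset.univ : Finset (Fin 3))
    (f := ![fun _ => 1, F, G]) (p := ![1 - u - v, u, v])
    (by intro i _; fin_cases i <;> simp [hF, hG])
    (by simp [Fin.sum_univ_three]; ring) (by intro i _; fin_cases i <;> simp <;> linarith)
  simpa [Fin.prod_univ_three, mul_assoc] using h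

lemma ckn_local_aux {X : Type*} [MeasurableSpace X] (μ : Measure X) {h g : X → ℝ≥0∞}
    (hh : AEMeasurable h μ) (hg : AEMeasurable g μ)
    {s p q T a : ℝ} (hs : 0 < s) (hp : 1 < p) (hq : 1 ≤ q) (hT : 1 ≤ T) (ha : 0 < a) (ha1 : a ≤ 1)
    (hκ : a * (1 / p - s) + (1 - a) / q ≤ 1 / T)
    (hN : (∫⁻ x, h x ^ T ∂μ) ≠ ⊤)
    (hpw : (∫⁻ x, h x ^ T ∂μ) ≠ 0 → ∀ᵐ x ∂μ, h x ≤ 2 * ((g x ^ (1 / p)) ^ (1 / (1 + T * s)) *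
      ((∫⁻ x, h x ^ T ∂μ) ^ (1 / T)) ^ (1 - 1 / (1 + T * s)))) :
    (∫⁻ x, h x ^ T ∂μ) ^ (1 / T) ≤ 2 ^ (a * (1 + T * s)) *
      (μ univ) ^ (1 / T - a * (1 / p - s) - (1 - a) / q) *
      ((∫⁻ x, g x ∂μ) ^ (a / p) * (∫⁻ x, h x ^ q ∂μ) ^ ((1 - a) / q)) := by
  have hT0 : 0 < T := by linarith
  have hp0 : 0 < p := by linarith
  have hq0 : 0 < q := by linarith
  have hTs : 0 < T * s := by positivity
  have haT : 0 < 1 + a * T * s := by positivity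
  have h1a : 0 ≤ 1 - a := by linarith
  set I := ∫⁻ x, h x ^ T ∂μ with hI
  by_cases hI0 : I = 0
  · rw [hI0, ENNReal.zero_rpow_of_pos (by positivity)]; simp
  specialize hpw hI0
  set N := I ^ (1 / T) with hNd
  have hN0 : N ≠ 0 := by rw [hNd, ne_eq, ENNReal.rpow_eq_zero_iff]; simp [hI0, hN]
  have hNt : N ≠ ⊤ := by
    rw [hNd]; exact ENNReal.rpow_ne_top_of_nonneg (by positivity) hN
  clear_value N
  set θ := 1 / (1 + T * s) with hθ
  have hθ0 : 0 < θ := by positivity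
  have hθ1 : θ ≤ 1 := by rw [hθ, div_le_one (by positivity)]; linarith
  set E := T / (1 + a * T * s) with hE
  set A := a * T * (1 + T * s) / (1 + a * T * s) with hA
  have hE0 : 0 < E := by positivity
  have hA0 : 0 < A := by positivity
  have r1 : A + (1 - a) * E = T := by rw [hA, hE]; field_simp; ring
  have r2 : θ * A = a * E := by rw [hA, hE, hθ]; field_simp
  have r3 : (1 - θ) * A = T - E := by rw [hA, hE, hθ]; field_simp; ring
  have r4 : 1 / E = 1 / T + a * s := by rw [hE]; field_simp
  have r5 : a * E / p + (1 - a) * E / q ≤ 1 := by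
    have : a * E / p + (1 - a) * E / q = E * (a / p + (1 - a) / q) := by ring
    rw [this]
    have h2 : a / p + (1 - a) / q ≤ 1 / E := by
      rw [r4]; have : a * (1 / p - s) = a / p - a * s := by ring
      linarith
    calc _ ≤ E * (1 / E) := by gcongr
      _ = 1 := by field_simp
  have hmain : I ≤ 2 ^ A * N ^ (T - E) * ((μ univ) ^ (1 - a * E / p - (1 - a) * E / q) *
      ((∫⁻ x, g x ∂μ) ^ (a * E / p) * (∫⁻ x, h x ^ q ∂μ) ^ ((1 - a) * E / q))) := by
    calc I ≤ ∫⁻ x, 2 ^ A * N ^ (T - E) * (g x ^ (a * E / p) * (h x ^ q) ^ ((1 - a) * E / q)) ∂μ := by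
          apply lintegral_mono_ae
          filter_upwards [hpw] with x hx
          calc h x ^ T = h x ^ A * h x ^ ((1 - a) * E) := by
                rw [← ENNReal.rpow_add_of_nonneg _ _ hA0.le (by positivity), r1]
            _ ≤ (2 * ((g x ^ (1 / p)) ^ θ * N ^ (1 - θ))) ^ A * h x ^ ((1 - a) * E) := by gcongr
            _ = _ := by
                rw [ENNReal.mul_rpow_of_nonneg _ _ hA0.le, ENNReal.mul_rpow_of_nonneg _ _ hA0.le,
                  ← ENNReal.rpow_mul, ← ENNReal.rpow_mul, ← ENNReal.rpow_mul, ← ENNReal.rpow_mul]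
                have t1 : 1 / p * (θ * A) = a * E / p := by rw [r2]; ring
                have t2 : q * ((1 - a) * E / q) = (1 - a) * E := by field_simp
                rw [t1, t2, r3]; ring
      _ = 2 ^ A * N ^ (T - E) * ∫⁻ x, (g x ^ (a * E / p) * (h x ^ q) ^ ((1 - a) * E / q)) ∂μ := by
          rw [lintegral_const_mul'' _ (by fun_prop)]
      _ ≤ _ := by
          gcongr
          exact ckn_hold3 μ hg (hh.pow_const q) (by positivity) (by positivity) r5
  have hIN : I = N ^ (T - E) * N ^ E := by
    rw [← ENNReal.rpow_add _ _ hN0 hNt, hNd, ← ENNReal.rpow_mul]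
    rw [show 1 / T * (T - E + E) = 1 by (field_simp; try ring_nf), ENNReal.rpow_one]
  have hNE0 : N ^ (T - E) ≠ 0 := by rw [ne_eq, ENNReal.rpow_eq_zero_iff]; simp [hN0, hNt]
  have hNEt : N ^ (T - E) ≠ ⊤ := by rw [ne_eq, ENNReal.rpow_eq_top_iff]; simp [hN0, hNt]
  have hfin : N ^ E ≤ 2 ^ A * ((μ univ) ^ (1 - a * E / p - (1 - a) * E / q) *
      ((∫⁻ x, g x ∂μ) ^ (a * E / p) * (∫⁻ x, h x ^ q ∂μ) ^ ((1 - a) * E / q))) := by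
    rw [← ENNReal.mul_le_mul_iff_right hNE0 hNEt, ← hIN]
    refine hmain.trans (le_of_eq (by ring))
  calc N = (N ^ E) ^ (1 / E) := by
        rw [← ENNReal.rpow_mul, mul_one_div_cancel hE0.ne', ENNReal.rpow_one]
    _ ≤ _ := ENNReal.rpow_le_rpow hfin (by positivity)
    _ = _ := by
      have hE' : 0 ≤ 1 / E := by positivity
      simp only [ENNReal.mul_rpow_of_nonneg _ _ hE', ← ENNReal.rpow_mul]
      have t1 : A * (1 / E) = a * (1 + T * s) := by rw [hA, hE]; field_simp
      have t2 : (1 - a * E / p - (1 - a) * E / q) * (1 / E) = 1 / T - a * (1 / p - s) - (1 - a) / q := by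
        have : (1 - a * E / p - (1 - a) * E / q) * (1 / E) = 1 / E - a / p - (1 - a) / q := by
          field_simp
        rw [this, r4]; ring
      have t3 : a * E / p * (1 / E) = a / p := by field_simp
      have t4 : (1 - a) * E / q * (1 / E) = (1 - a) / q := by field_simp
      rw [t1, t2, t3, t4]; ring

lemma ckn_avg_q {q : ℝ} (hq : 1 ≤ q) {f : ℝ → ℝ} (hf : Measurable f)
    {b L : ℝ} (hL : 0 < L) :
    ENNReal.ofReal L * ‖⨍ y in Ioc b (b + L), f y‖ₑ ^ q ≤ ∫⁻ x in Ioc b (b + L), ‖f x‖ₑ ^ q := by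
  have hq0 : 0 < q := by linarith
  have h3 : (volume.restrict (Ioc b (b + L))) univ = ENNReal.ofReal L := by simp
  have hL0 : ENNReal.ofReal L ≠ 0 := by simpa using hL
  have hLt : ENNReal.ofReal L ≠ ⊤ := ENNReal.ofReal_ne_top
  have h1 := ckn_hold (volume.restrict (Ioc b (b + L))) (F := fun y => ‖f y‖ₑ) (by fun_prop) hq
  rw [h3] at h1
  have h2 : ENNReal.ofReal L * ‖⨍ y in Ioc b (b + L), f y‖ₑ ≤ ∫⁻ x in Ioc b (b + L), ‖f x‖ₑ := by
    have h6 : L * (⨍ y in Ioc b (b + L), f y) = ∫ y in Ioc b (b + L), f y := by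
      rw [setAverage_eq]; simp [Measure.real, hL.le]; field_simp
    calc _ = ‖L * (⨍ y in Ioc b (b + L), f y)‖ₑ := by
            rw [enorm_mul, Real.enorm_of_nonneg hL.le]
      _ ≤ _ := by rw [h6]; exact enorm_integral_le_lintegral_enorm _
  have h4 := ENNReal.rpow_le_rpow (h2.trans h1) hq0.le
  rw [ENNReal.mul_rpow_of_nonneg _ _ hq0.le, ENNReal.mul_rpow_of_nonneg _ _ hq0.le,
    ← ENNReal.rpow_mul, ← ENNReal.rpow_mul, one_div_mul_cancel hq0.ne', ENNReal.rpow_one,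
    show (1 - 1 / q) * q = q - 1 by field_simp] at h4
  have h5 : ENNReal.ofReal L ^ (q - 1) ≠ 0 := by
    rw [ne_eq, ENNReal.rpow_eq_zero_iff]; simp [hL]
  have h6 : ENNReal.ofReal L ^ (q - 1) ≠ ⊤ :=
    ENNReal.rpow_ne_top_of_nonneg (by linarith) hLt
  rw [← ENNReal.mul_le_mul_iff_right h5 h6, ← mul_assoc]
  refine le_trans (le_of_eq ?_) h4
  congr 1
  conv_lhs => rw [← ENNReal.rpow_one (ENNReal.ofReal L), ← ENNReal.rpow_mul, ← ENNReal.rpow_add _ _ hL0 hLt]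
  congr 1; ring

lemma ckn_sub_q {q : ℝ} (hq : 1 ≤ q) {f : ℝ → ℝ} (hf : Measurable f)
    {b L : ℝ} (hL : 0 < L) :
    ∫⁻ x in Ioc b (b + L), ‖f x - ⨍ y in Ioc b (b + L), f y‖ₑ ^ q ≤
      2 ^ q * ∫⁻ x in Ioc b (b + L), ‖f x‖ₑ ^ q := by
  have hq0 : 0 < q := by linarith
  have h3 : (volume.restrict (Ioc b (b + L))) univ = ENNReal.ofReal L := by simp
  have h1 := ckn_avg_q hq hf hL (b := b)
  set c := ⨍ y in Ioc b (b + L), f y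
  calc _ ≤ ∫⁻ x in Ioc b (b + L), 2 ^ (q - 1) * (‖f x‖ₑ ^ q + ‖c‖ₑ ^ q) := by
        apply lintegral_mono; intro x
        calc ‖f x - c‖ₑ ^ q ≤ (‖f x‖ₑ + ‖c‖ₑ) ^ q := by gcongr; exact enorm_sub_le
          _ ≤ _ := ENNReal.rpow_add_le_mul_rpow_add_rpow _ _ hq
    _ = 2 ^ (q - 1) * ((∫⁻ x in Ioc b (b + L), ‖f x‖ₑ ^ q) + ENNReal.ofReal L * ‖c‖ₑ ^ q) := by
        rw [lintegral_const_mul _ (by fun_prop), lintegral_add_left (by fun_prop), lintegral_const, h3,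
          mul_comm (‖c‖ₑ ^ q)]
    _ ≤ 2 ^ (q - 1) * ((∫⁻ x in Ioc b (b + L), ‖f x‖ₑ ^ q) + ∫⁻ x in Ioc b (b + L), ‖f x‖ₑ ^ q) := by
        gcongr
    _ = _ := by
        rw [← two_mul, ← mul_assoc]; congr 1
        conv_lhs => rw [← ENNReal.rpow_one (2:ℝ≥0∞), ← ENNReal.rpow_mul, ← ENNReal.rpow_add _ _ (by simp) (by simp)]
        congr 1; ring

lemma ckn_local {s p q T a : ℝ} (hs : 0 < s) (hp : 1 < p) (hq : 1 ≤ q) (hT : 1 ≤ T) (ha : 0 < a)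
    (ha1 : a ≤ 1) (hκ : a * (1 / p - s) + (1 - a) / q ≤ 1 / T) :
    ∃ C : ℝ, 0 < C ∧ ∀ (f : ℝ → ℝ) (M b L : ℝ), Measurable f → (∀ x, |f x| ≤ M) → 0 < L →
      ∫⁻ x in Ioc b (b + L), ‖f x - ⨍ y in Ioc b (b + L), f y‖ₑ ^ T ≤
        ENNReal.ofReal (C * L ^ ((1 / T - a * (1 / p - s) - (1 - a) / q) * T)) *
        ((∫⁻ x in Ioc b (b + L), cknG s p f (Ioc b (b + L)) x) ^ (a * T / p) *
          (∫⁻ x in Ioc b (b + L), ‖f x‖ₑ ^ q) ^ ((1 - a) * T / q)) := by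
  have hT0 : 0 < T := by linarith
  have hp0 : 0 < p := by linarith
  have hq0 : 0 < q := by linarith
  have h1a : 0 ≤ 1 - a := by linarith
  refine ⟨2 ^ (a * (1 + T * s) * T) * 2 ^ ((1 - a) * T), by positivity, ?_⟩
  intro f M b L hf hM hL
  have h3 : (volume.restrict (Ioc b (b + L))) univ = ENNReal.ofReal L := by simp
  set c := ⨍ y in Ioc b (b + L), f y with hc
  have hfin : (∫⁻ x in Ioc b (b + L), ‖f x - c‖ₑ ^ T) ≠ ⊤ := by
    refine ne_top_of_le_ne_top (b := ∫⁻ x in Ioc b (b + L), (ENNReal.ofReal (M + |c|)) ^ T) ?_ ?_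
    · rw [lintegral_const, h3]
      exact ENNReal.mul_ne_top (ENNReal.rpow_ne_top_of_nonneg hT0.le ENNReal.ofReal_ne_top) ENNReal.ofReal_ne_top
    · apply lintegral_mono; intro x
      dsimp only
      gcongr
      rw [Real.enorm_eq_ofReal_abs]
      apply ENNReal.ofReal_le_ofReal
      exact (abs_sub _ _).trans (by linarith [hM x])
  have haux := ckn_local_aux (volume.restrict (Ioc b (b + L))) (h := fun x => ‖f x - c‖ₑ)
    (g := cknG s p f (Ioc b (b + L))) (by fun_prop) (cknG_measurable s p hf _).aemeasurable
    hs hp hq hT ha ha1 hκ hfin (by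
      intro hN
      rw [ae_restrict_iff' measurableSet_Ioc]
      refine Filter.Eventually.of_forall fun x hx => ?_
      refine ckn_opt hs hT hL ?_ ?_ ?_ ?_
      · rw [ne_eq, ENNReal.rpow_eq_zero_iff]; simp only [hN, hfin]; simp
      · exact ENNReal.rpow_ne_top_of_nonneg (by positivity) hfin
      · intro ρ hρ hρL
        exact ckn_two hs hp hT hf hρ hρL hx
      · exact ckn_mean hs hp hf hM hL hx)
  have h4 := ENNReal.rpow_le_rpow haux hT0.le
  rw [h3] at h4
  have h5 := ckn_sub_q hq hf hL (b := b)
  rw [← hc] at h5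
  rw [← ENNReal.rpow_mul, one_div_mul_cancel hT0.ne', ENNReal.rpow_one] at h4
  refine h4.trans ?_
  simp only [ENNReal.mul_rpow_of_nonneg _ _ hT0.le, ← ENNReal.rpow_mul]
  have e1 : a / p * T = a * T / p := by ring
  have e2 : (1 - a) / q * T = (1 - a) * T / q := by ring
  have e3 : (2 : ℝ≥0∞) = ENNReal.ofReal 2 := by simp
  rw [e1, e2]
  calc _ ≤ 2 ^ (a * (1 + T * s) * T) * ENNReal.ofReal L ^ ((1 / T - a * (1 / p - s) - (1 - a) / q) * T) *
      ((∫⁻ x in Ioc b (b + L), cknG s p f (Ioc b (b + L)) x) ^ (a * T / p) *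
        (2 ^ q * ∫⁻ x in Ioc b (b + L), ‖f x‖ₑ ^ q) ^ ((1 - a) * T / q)) := by
        gcongr
    _ = _ := by
        rw [ENNReal.mul_rpow_of_nonneg _ _ (by positivity), ← ENNReal.rpow_mul,
          show q * ((1 - a) * T / q) = (1 - a) * T by field_simp, e3,
          ENNReal.ofReal_rpow_of_pos hL, ENNReal.ofReal_rpow_of_pos two_pos,
          ENNReal.ofReal_rpow_of_pos two_pos, ENNReal.ofReal_mul (by positivity),
          ENNReal.ofReal_mul (by positivity)]
        ring

lemma ckn_w (e : ℝ) {Λ R r : ℝ} (hΛ : 1 < Λ) (hR : 0 < R) (h1 : R / Λ ≤ r) (h2 : r ≤ R) :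
    r ^ e ≤ Λ ^ |e| * R ^ e ∧ R ^ e ≤ Λ ^ |e| * r ^ e := by
  have hΛ0 : 0 < Λ := by linarith
  have hr : 0 < r := lt_of_lt_of_le (by positivity) h1
  have h3 : R ≤ Λ * r := by rw [div_le_iff₀ hΛ0] at h1; linarith
  have hone : 1 ≤ Λ ^ |e| := Real.one_le_rpow hΛ.le (abs_nonneg _)
  rcases le_or_gt 0 e with he | he
  · rw [abs_of_nonneg he] at *
    constructor
    · calc r ^ e ≤ R ^ e := Real.rpow_le_rpow hr.le h2 he
        _ ≤ _ := le_mul_of_one_le_left (by positivity) hone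
    · rw [← Real.mul_rpow hΛ0.le hr.le]
      exact Real.rpow_le_rpow hR.le h3 he
  · constructor
    · calc r ^ e ≤ (R / Λ) ^ e := Real.rpow_le_rpow_of_nonpos (by positivity) h1 he.le
        _ = _ := by
          rw [abs_of_neg he, Real.div_rpow hR.le hΛ0.le, Real.rpow_neg hΛ0.le]; field_simp
    · calc R ^ e ≤ r ^ e := Real.rpow_le_rpow_of_nonpos hr h2 he.le
        _ ≤ _ := le_mul_of_one_le_left (by positivity) hone

lemma ckn_seq {ε : ℝ} (h0 : 0 ≤ ε) (h1 : ε < 1) {v w : ℕ → ℝ≥0∞} (hv0 : v 0 = 0)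
    (hv : ∀ j, v (j + 1) ≤ ENNReal.ofReal ε * v j + w j) :
    ∑' j, v j ≤ ENNReal.ofReal (1 - ε)⁻¹ * ∑' j, w j := by
  set W := ∑' j, w j
  have hn : ∀ n, ∑ j ∈ Finset.range n, v j ≤ ENNReal.ofReal (1 - ε)⁻¹ * W := by
    intro n
    induction n with
    | zero => simp
    | succ n ih =>
      rw [Finset.sum_range_succ', hv0, add_zero]
      calc _ ≤ ∑ j ∈ Finset.range n, (ENNReal.ofReal ε * v j + w j) := Finset.sum_le_sum fun j _ => hv j
        _ = ENNReal.ofReal ε * (∑ j ∈ Finset.range n, v j) + ∑ j ∈ Finset.range n, w j := by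
          rw [Finset.sum_add_distrib, Finset.mul_sum]
        _ ≤ ENNReal.ofReal ε * (ENNReal.ofReal (1 - ε)⁻¹ * W) + W := by
          gcongr
          exact ENNReal.sum_le_tsum _
        _ = _ := by
          have hε : 0 < 1 - ε := by linarith
          have : ENNReal.ofReal (1 - ε)⁻¹ = ENNReal.ofReal ε * ENNReal.ofReal (1 - ε)⁻¹ + 1 := by
            rw [← ENNReal.ofReal_mul h0, ← ENNReal.ofReal_one, ← ENNReal.ofReal_add (by positivity) (by positivity)]
            congr 1; field_simp; ring
          conv_rhs => rw [this]
          ring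
  exact ENNReal.tsum_le_of_sum_range_le hn

lemma ckn_tsum_holder (x y : ℕ → ℝ≥0∞) {P Q : ℝ} (hP : 0 ≤ P) (hQ : 0 ≤ Q) (hPQ : 1 ≤ P + Q) :
    ∑' j, x j ^ P * y j ^ Q ≤ (∑' j, x j) ^ P * (∑' j, y j) ^ Q := by
  set ν := P + Q with hν
  have hν0 : 0 < ν := by linarith
  set X := ∑' j, x j
  set Y := ∑' j, y j
  have h1 : ∑' j, x j ^ (P / ν) * y j ^ (Q / ν) ≤ X ^ (P / ν) * Y ^ (Q / ν) := by
    have := ENNReal.lintegral_mul_norm_pow_le (μ := Measure.count) (f := x) (g := y)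
      (measurable_of_countable _).aemeasurable (measurable_of_countable _).aemeasurable
      (p := P / ν) (q := Q / ν) (by positivity) (by positivity) (by rw [← add_div, ← hν, div_self hν0.ne'])
    simpa only [lintegral_count] using this
  have eP : P / ν + P / ν * (ν - 1) = P := by field_simp; ring
  have eQ : Q / ν + Q / ν * (ν - 1) = Q := by field_simp; ring
  have hν1 : 0 ≤ ν - 1 := by linarith
  have key : ∀ A B : ℝ≥0∞, A ^ P * B ^ Q = (A ^ (P / ν) * B ^ (Q / ν)) * (A ^ (P / ν * (ν - 1)) * B ^ (Q / ν * (ν - 1))) := by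
    intro A B
    conv_lhs => rw [← eP, ← eQ, ENNReal.rpow_add_of_nonneg _ _ (by positivity) (by positivity),
      ENNReal.rpow_add_of_nonneg _ _ (by positivity) (by positivity)]
    ring
  rw [key X Y]
  calc ∑' j, x j ^ P * y j ^ Q ≤ ∑' j, (x j ^ (P / ν) * y j ^ (Q / ν)) * (X ^ (P / ν * (ν - 1)) * Y ^ (Q / ν * (ν - 1))) := by
        apply ENNReal.tsum_le_tsum; intro j
        rw [key]
        gcongr
        · exact ENNReal.le_tsum j
        · exact ENNReal.le_tsum j
    _ = _ := ENNReal.tsum_mul_right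
    _ ≤ _ := by gcongr

lemma ckn_cover {R : ℕ → ℝ} (hR : Antitone R) (hpos : ∀ j, 0 < R j) (Φ : ℝ → ℝ≥0∞) :
    ∑' j, ∫⁻ r in Ioc (R (j + 2)) (R j), Φ r ≤ 2 * ∫⁻ r in Ioi 0, Φ r := by
  have hI : ∑' j, ∫⁻ r in Ioc (R (j + 1)) (R j), Φ r ≤ ∫⁻ r in Ioi 0, Φ r := by
    rw [← lintegral_iUnion (s := fun j => Ioc (R (j + 1)) (R j)) (fun j => measurableSet_Ioc) hR.pairwise_disjoint_on_Ioc_succ]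
    apply lintegral_mono_set
    apply iUnion_subset
    intro j r hr
    exact (hpos _).trans hr.1
  calc _ ≤ ∑' j, ((∫⁻ r in Ioc (R (j + 1)) (R j), Φ r) + ∫⁻ r in Ioc (R (j + 1 + 1)) (R (j + 1)), Φ r) := by
        apply ENNReal.tsum_le_tsum; intro j
        rw [← Ioc_union_Ioc_eq_Ioc (hR (show j + 1 ≤ j + 2 by omega)) (hR (show j ≤ j + 1 by omega)), add_comm (∫⁻ r in Ioc (R (j + 1)) (R j), Φ r)]
        exact lintegral_union_le _ _ _
    _ = (∑' j, ∫⁻ r in Ioc (R (j + 1)) (R j), Φ r) + ∑' j, ∫⁻ r in Ioc (R (j + 1 + 1)) (R (j + 1)), Φ r :=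
        ENNReal.tsum_add
    _ ≤ (∑' j, ∫⁻ r in Ioc (R (j + 1)) (R j), Φ r) + ∑' j, ∫⁻ r in Ioc (R (j + 1)) (R j), Φ r := by
        refine add_le_add le_rfl ?_
        exact ENNReal.tsum_comp_le_tsum_of_injective (add_left_injective 1) (fun j => ∫⁻ r in Ioc (R (j + 1)) (R j), Φ r)
    _ ≤ _ := by rw [two_mul]; gcongr

lemma ckn_step {s p q T a e0 e1 e2 Λ : ℝ} (hs : 0 < s) (hp : 1 < p) (hq : 1 ≤ q) (hT : 1 ≤ T)
    (ha : 0 < a) (ha1 : a ≤ 1) (hΛ : 1 < Λ) (hκ : a * (1 / p - s) + (1 - a) / q ≤ 1 / T)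
    (hsc : e0 + (1 / T - a * (1 / p - s) - (1 - a) / q) * T - e1 * (a * T / p) -
      e2 * ((1 - a) * T / q) = 0) :
    ∃ C : ℝ, 0 < C ∧ ∀ (f : ℝ → ℝ) (M R : ℝ), Measurable f → (∀ x, |f x| ≤ M) → 0 < R →
      ENNReal.ofReal (R ^ e0) * ∫⁻ x in Ioc (R / Λ) R, ‖f x - ⨍ y in Ioc (R / Λ) R, f y‖ₑ ^ T ≤
        ENNReal.ofReal C *
        ((∫⁻ r in Ioc (R / Λ) R, ENNReal.ofReal (r ^ e1) * cknG s p f (Icc (Λ⁻¹ * r) (Λ * r)) r) ^ (a * T / p) *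
          (∫⁻ r in Ioc (R / Λ) R, ENNReal.ofReal (r ^ e2) * ‖f r‖ₑ ^ q) ^ ((1 - a) * T / q)) := by
  have hT0 : 0 < T := by linarith
  have hp0 : 0 < p := by linarith
  have hq0 : 0 < q := by linarith
  have h1a : 0 ≤ 1 - a := by linarith
  have hΛ0 : 0 < Λ := by linarith
  have hl : 0 < 1 - Λ⁻¹ := by rw [sub_pos]; exact inv_lt_one_of_one_lt₀ hΛ
  obtain ⟨C, hC, hloc⟩ := ckn_local hs hp hq hT ha ha1 hκ
  set k := (1 / T - a * (1 / p - s) - (1 - a) / q) * T with hk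
  set P := a * T / p with hP
  set Q := (1 - a) * T / q with hQ
  have hP0 : 0 ≤ P := by positivity
  have hQ0 : 0 ≤ Q := by positivity
  refine ⟨C * (1 - Λ⁻¹) ^ k * (Λ ^ |e1|) ^ P * (Λ ^ |e2|) ^ Q, by positivity, ?_⟩
  intro f M R hf hM hR
  have h := hloc f M (R / Λ) (R * (1 - Λ⁻¹)) hf hM (by positivity)
  rw [show R / Λ + R * (1 - Λ⁻¹) = R by field_simp; ring] at h
  set B := Ioc (R / Λ) R with hB
  have hx : ENNReal.ofReal (R ^ e1) * (∫⁻ x in B, cknG s p f B x) ≤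
      ENNReal.ofReal (Λ ^ |e1|) * ∫⁻ r in B, ENNReal.ofReal (r ^ e1) * cknG s p f (Icc (Λ⁻¹ * r) (Λ * r)) r := by
    rw [← lintegral_const_mul' _ _ ENNReal.ofReal_ne_top, ← lintegral_const_mul' _ _ ENNReal.ofReal_ne_top]
    refine setLIntegral_mono' measurableSet_Ioc ?_
    intro r hr
    have hr0 : 0 < r := lt_trans (by positivity) hr.1
    rw [← mul_assoc, ← ENNReal.ofReal_mul (by positivity)]
    gcongr
    · exact (ckn_w e1 hΛ hR hr.1.le hr.2).2
    · unfold cknG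
      apply lintegral_mono_set
      intro t ht
      have h1 := hr.1; have h2 := ht.1
      rw [div_lt_iff₀ hΛ0] at h1 h2
      constructor
      · rw [inv_mul_le_iff₀ hΛ0]; linarith [hr.2]
      · linarith [ht.2]
  have hy : ENNReal.ofReal (R ^ e2) * (∫⁻ x in B, ‖f x‖ₑ ^ q) ≤
      ENNReal.ofReal (Λ ^ |e2|) * ∫⁻ r in B, ENNReal.ofReal (r ^ e2) * ‖f r‖ₑ ^ q := by
    rw [← lintegral_const_mul' _ _ ENNReal.ofReal_ne_top, ← lintegral_const_mul' _ _ ENNReal.ofReal_ne_top]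
    refine setLIntegral_mono' measurableSet_Ioc ?_
    intro r hr
    have hr0 : 0 < r := lt_trans (by positivity) hr.1
    rw [← mul_assoc, ← ENNReal.ofReal_mul (by positivity)]
    gcongr
    exact (ckn_w e2 hΛ hR hr.1.le hr.2).2
  have hx' := ENNReal.rpow_le_rpow hx hP0
  have hy' := ENNReal.rpow_le_rpow hy hQ0
  rw [ENNReal.mul_rpow_of_nonneg _ _ hP0, ENNReal.mul_rpow_of_nonneg _ _ hP0,
    ENNReal.ofReal_rpow_of_pos (by positivity), ENNReal.ofReal_rpow_of_pos (by positivity)] at hx'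
  rw [ENNReal.mul_rpow_of_nonneg _ _ hQ0, ENNReal.mul_rpow_of_nonneg _ _ hQ0,
    ENNReal.ofReal_rpow_of_pos (by positivity), ENNReal.ofReal_rpow_of_pos (by positivity)] at hy'
  set Gx := (∫⁻ x in B, cknG s p f B x) ^ P
  set Gy := (∫⁻ x in B, ‖f x‖ₑ ^ q) ^ Q
  have hreal : R ^ e0 * (C * (R * (1 - Λ⁻¹)) ^ k) = C * (1 - Λ⁻¹) ^ k * ((R ^ e1) ^ P * (R ^ e2) ^ Q) := by
    rw [Real.mul_rpow hR.le hl.le, ← Real.rpow_mul hR.le, ← Real.rpow_mul hR.le, ← Real.rpow_add hR]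
    rw [show e1 * P + e2 * Q = e0 + k by linarith, Real.rpow_add hR]; ring
  calc _ ≤ ENNReal.ofReal (R ^ e0) * (ENNReal.ofReal (C * (R * (1 - Λ⁻¹)) ^ k) * (Gx * Gy)) := by gcongr
    _ = ENNReal.ofReal (C * (1 - Λ⁻¹) ^ k) * ((ENNReal.ofReal ((R ^ e1) ^ P) * Gx) * (ENNReal.ofReal ((R ^ e2) ^ Q) * Gy)) := by
        rw [← mul_assoc, ← ENNReal.ofReal_mul (by positivity), hreal, ENNReal.ofReal_mul (p := C * (1 - Λ⁻¹) ^ k) (by positivity),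
          ENNReal.ofReal_mul (p := (R ^ e1) ^ P) (by positivity)]; ring
    _ ≤ _ := mul_le_mul_right (mul_le_mul' hx' hy') _
    _ = _ := by
        rw [ENNReal.ofReal_mul (p := C * (1 - Λ⁻¹) ^ k * (Λ ^ |e1|) ^ P) (by positivity), ENNReal.ofReal_mul (p := C * (1 - Λ⁻¹) ^ k) (by positivity)]
        ring

lemma ckn_conv {ε T x y : ℝ} (h0 : 0 < ε) (h1 : ε < 1) (hT : 1 ≤ T) (hx : 0 ≤ x) (hy : 0 ≤ y) :
    (x + y) ^ T ≤ ε ^ (1 - T) * x ^ T + (1 - ε) ^ (1 - T) * y ^ T := by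
  have hε : 0 < 1 - ε := by linarith
  have h := (convexOn_rpow hT).2 (x := x / ε) (y := y / (1 - ε)) (by simp; positivity) (by simp; positivity)
    h0.le hε.le (by ring)
  simp only [smul_eq_mul] at h
  rw [mul_div_cancel₀ _ h0.ne', mul_div_cancel₀ _ hε.ne', Real.div_rpow hx h0.le,
    Real.div_rpow hy hε.le] at h
  refine h.trans (le_of_eq ?_)
  rw [Real.rpow_sub h0, Real.rpow_sub hε, Real.rpow_one, Real.rpow_one]
  ring

lemma ckn_split {T : ℝ} (hT : 1 ≤ T) (x y : ℝ) :
    ‖x + y‖ₑ ^ T ≤ 2 ^ (T - 1) * (‖x‖ₑ ^ T + ‖y‖ₑ ^ T) :=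
  (ENNReal.rpow_le_rpow (enorm_add_le _ _) (by linarith)).trans
    (ENNReal.rpow_add_le_mul_rpow_add_rpow _ _ hT)

lemma ckn_pt {T e0 Λ R : ℝ} (hT : 1 ≤ T) (hΛ : 1 < Λ) (hR : 0 < R) {f : ℝ → ℝ} (hf : Measurable f)
    (c : ℝ) :
    ∫⁻ r in Ioc (R / Λ) R, ENNReal.ofReal (r ^ e0) * ‖f r‖ₑ ^ T ≤
      ENNReal.ofReal (Λ ^ |e0| * 2 ^ (T - 1)) *
      (ENNReal.ofReal (R ^ e0) * (∫⁻ r in Ioc (R / Λ) R, ‖f r - c‖ₑ ^ T) +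
        ENNReal.ofReal (R ^ (e0 + 1)) * ‖c‖ₑ ^ T) := by
  have hΛ0 : 0 < Λ := by linarith
  have e3 : (2 : ℝ≥0∞) ^ (T - 1) = ENNReal.ofReal (2 ^ (T - 1)) := by
    rw [← ENNReal.ofReal_rpow_of_pos two_pos]; simp
  calc _ ≤ ∫⁻ r in Ioc (R / Λ) R, ENNReal.ofReal (Λ ^ |e0| * 2 ^ (T - 1)) * (ENNReal.ofReal (R ^ e0) *
        (‖f r - c‖ₑ ^ T + ‖c‖ₑ ^ T)) := by
        refine setLIntegral_mono' measurableSet_Ioc ?_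
        intro r hr
        have h1 := (ckn_w e0 hΛ hR hr.1.le hr.2).1
        have h2 := ckn_split hT (f r - c) c
        rw [sub_add_cancel, e3] at h2
        calc _ ≤ ENNReal.ofReal (Λ ^ |e0| * R ^ e0) * (ENNReal.ofReal (2 ^ (T - 1)) * (‖f r - c‖ₑ ^ T + ‖c‖ₑ ^ T)) := by
              gcongr
          _ = _ := by
              rw [ENNReal.ofReal_mul (by positivity), ENNReal.ofReal_mul (by positivity)]; ring
    _ = ENNReal.ofReal (Λ ^ |e0| * 2 ^ (T - 1)) * (ENNReal.ofReal (R ^ e0) *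
        ((∫⁻ r in Ioc (R / Λ) R, ‖f r - c‖ₑ ^ T) + ‖c‖ₑ ^ T * ENNReal.ofReal (R - R / Λ))) := by
        rw [lintegral_const_mul _ (by fun_prop), lintegral_const_mul _ (by fun_prop),
          lintegral_add_left (by fun_prop), lintegral_const]
        simp
    _ ≤ ENNReal.ofReal (Λ ^ |e0| * 2 ^ (T - 1)) * (ENNReal.ofReal (R ^ e0) *
        ((∫⁻ r in Ioc (R / Λ) R, ‖f r - c‖ₑ ^ T) + ‖c‖ₑ ^ T * ENNReal.ofReal R)) := by
        gcongr
        have : 0 < R / Λ := by positivity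
        linarith
    _ = _ := by
        rw [Real.rpow_add hR, Real.rpow_one, ENNReal.ofReal_mul (p := R ^ e0) (by positivity)]
        generalize (∫⁻ r in Ioc (R / Λ) R, ‖f r - c‖ₑ ^ T) = Z
        ring

lemma ckn_tele {T e0 l R : ℝ} (hT : 1 ≤ T) (he : 0 < e0 + 1) (hl : 1 < l) (hR : 0 < R) {f : ℝ → ℝ}
    (hf : Measurable f) (c c' : ℝ) :
    ENNReal.ofReal ((R / l) ^ (e0 + 1)) * ‖c'‖ₑ ^ T ≤
      ENNReal.ofReal (l ^ (-((e0 + 1) / T))) * (ENNReal.ofReal (R ^ (e0 + 1)) * ‖c‖ₑ ^ T) +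
      ENNReal.ofReal ((1 - l ^ (-((e0 + 1) / T))) ^ (1 - T) * (1 - l⁻¹)⁻¹ * 2 ^ (T - 1) * (l ^ 2) ^ |e0|) *
       (ENNReal.ofReal (R ^ e0) * (∫⁻ r in Ioc (R / l ^ 2) R, ‖f r - c‖ₑ ^ T) +
        ENNReal.ofReal ((R / l) ^ e0) * (∫⁻ r in Ioc (R / l / l ^ 2) (R / l), ‖f r - c'‖ₑ ^ T)) := by
  have hl0 : 0 < l := by linarith
  have hT0 : 0 < T := by linarith
  set D := e0 + 1 with hD
  set ε := l ^ (-(D / T)) with hε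
  have hε0 : 0 < ε := by positivity
  have hε1 : ε < 1 := Real.rpow_lt_one_of_one_lt_of_neg hl (by rw [neg_lt_zero]; positivity)
  have hε2 : 0 < 1 - ε := by linarith
  have hl1 : 0 < 1 - l⁻¹ := by rw [sub_pos]; exact inv_lt_one_of_one_lt₀ hl
  have hl2 : 1 < l ^ 2 := one_lt_pow₀ hl two_ne_zero
  have hl3 : R / l ^ 2 ≤ R / l := by
    apply div_le_div_of_nonneg_left hR.le hl0; nlinarith
  have hl4 : R / l ≤ R := div_le_self hR.le hl.le
  have hl5 : R / l / l ^ 2 ≤ R / l ^ 2 := by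
    gcongr
  have e3 : (2 : ℝ≥0∞) ^ (T - 1) = ENNReal.ofReal (2 ^ (T - 1)) := by
    rw [← ENNReal.ofReal_rpow_of_pos two_pos]; simp
  set n := ∫⁻ r in Ioc (R / l ^ 2) R, ‖f r - c‖ₑ ^ T with hn
  set n' := ∫⁻ r in Ioc (R / l / l ^ 2) (R / l), ‖f r - c'‖ₑ ^ T with hn'
  have hΔ : ENNReal.ofReal (R / l * (1 - l⁻¹)) * ‖c' - c‖ₑ ^ T ≤ ENNReal.ofReal (2 ^ (T - 1)) * (n + n') := by
    calc _ = ∫⁻ r in Ioc (R / l ^ 2) (R / l), ‖c' - c‖ₑ ^ T := by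
          rw [lintegral_const, mul_comm]; simp; congr 2; field_simp
      _ ≤ ∫⁻ r in Ioc (R / l ^ 2) (R / l), ENNReal.ofReal (2 ^ (T - 1)) * (‖f r - c‖ₑ ^ T + ‖f r - c'‖ₑ ^ T) := by
          apply lintegral_mono; intro r
          have h := ckn_split hT (f r - c) (-(f r - c'))
          rw [enorm_neg, e3] at h
          simpa [show f r - c + -(f r - c') = c' - c by ring] using h
      _ = ENNReal.ofReal (2 ^ (T - 1)) * ((∫⁻ r in Ioc (R / l ^ 2) (R / l), ‖f r - c‖ₑ ^ T) +
          ∫⁻ r in Ioc (R / l ^ 2) (R / l), ‖f r - c'‖ₑ ^ T) := by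
          rw [lintegral_const_mul _ (by fun_prop), lintegral_add_left (by fun_prop)]
      _ ≤ _ := by
          refine mul_le_mul_right (add_le_add ?_ ?_) _
          · exact lintegral_mono_set (Ioc_subset_Ioc le_rfl hl4)
          · exact lintegral_mono_set (Ioc_subset_Ioc hl5 le_rfl)
  have hc : ‖c'‖ₑ ^ T ≤ ENNReal.ofReal (ε ^ (1 - T)) * ‖c‖ₑ ^ T + ENNReal.ofReal ((1 - ε) ^ (1 - T)) * ‖c' - c‖ₑ ^ T := by
    simp only [Real.enorm_eq_ofReal_abs, ENNReal.ofReal_rpow_of_nonneg (abs_nonneg _) hT0.le]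
    rw [← ENNReal.ofReal_mul (by positivity), ← ENNReal.ofReal_mul (by positivity), ← ENNReal.ofReal_add (by positivity) (by positivity)]
    apply ENNReal.ofReal_le_ofReal
    refine le_trans ?_ (ckn_conv hε0 hε1 hT (abs_nonneg c) (abs_nonneg (c' - c)))
    gcongr
    have := abs_add_le c (c' - c)
    simpa using this
  have hw := (ckn_w e0 hl2 hR hl3 hl4).1
  have hone : 1 ≤ (l ^ 2) ^ |e0| := Real.one_le_rpow hl2.le (abs_nonneg _)
  have hr1 : (R / l) ^ D * ε ^ (1 - T) = ε * R ^ D := by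
    rw [Real.div_rpow hR.le hl0.le, hε, ← Real.rpow_mul hl0.le, div_mul_eq_mul_div, div_eq_iff (by positivity),
      mul_comm (R ^ D), mul_right_comm, ← Real.rpow_add hl0]
    congr 2
    field_simp; ring
  have hr2 : (R / l) ^ D = (R / l) ^ e0 * ((1 - l⁻¹)⁻¹ * (R / l * (1 - l⁻¹))) := by
    rw [hD, Real.rpow_add (by positivity), Real.rpow_one, mul_comm (R / l) (1 - l⁻¹), inv_mul_cancel_left₀ hl1.ne']
  calc _ ≤ ENNReal.ofReal ((R / l) ^ D) * (ENNReal.ofReal (ε ^ (1 - T)) * ‖c‖ₑ ^ T + ENNReal.ofReal ((1 - ε) ^ (1 - T)) * ‖c' - c‖ₑ ^ T) := by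
        gcongr
    _ = ENNReal.ofReal ε * (ENNReal.ofReal (R ^ D) * ‖c‖ₑ ^ T) + ENNReal.ofReal ((1 - ε) ^ (1 - T) * (1 - l⁻¹)⁻¹) *
        (ENNReal.ofReal ((R / l) ^ e0) * (ENNReal.ofReal (R / l * (1 - l⁻¹)) * ‖c' - c‖ₑ ^ T)) := by
        rw [mul_add, ← mul_assoc, ← ENNReal.ofReal_mul (by positivity), hr1, ENNReal.ofReal_mul (by positivity), mul_assoc]
        congr 1
        rw [hr2, ENNReal.ofReal_mul (by positivity), ENNReal.ofReal_mul (by positivity), ENNReal.ofReal_mul (p := (1 - ε) ^ (1 - T)) (by positivity)]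
        ring
    _ ≤ ENNReal.ofReal ε * (ENNReal.ofReal (R ^ D) * ‖c‖ₑ ^ T) + ENNReal.ofReal ((1 - ε) ^ (1 - T) * (1 - l⁻¹)⁻¹) *
        (ENNReal.ofReal ((R / l) ^ e0) * (ENNReal.ofReal (2 ^ (T - 1)) * (n + n'))) :=
        add_le_add le_rfl (mul_le_mul_right (mul_le_mul_right hΔ _) _)
    _ = ENNReal.ofReal ε * (ENNReal.ofReal (R ^ D) * ‖c‖ₑ ^ T) + ENNReal.ofReal ((1 - ε) ^ (1 - T) * (1 - l⁻¹)⁻¹ * 2 ^ (T - 1)) *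
        (ENNReal.ofReal ((R / l) ^ e0) * n + ENNReal.ofReal ((R / l) ^ e0) * n') := by
        rw [ENNReal.ofReal_mul (p := (1 - ε) ^ (1 - T) * (1 - l⁻¹)⁻¹) (by positivity)]; ring
    _ ≤ ENNReal.ofReal ε * (ENNReal.ofReal (R ^ D) * ‖c‖ₑ ^ T) + ENNReal.ofReal ((1 - ε) ^ (1 - T) * (1 - l⁻¹)⁻¹ * 2 ^ (T - 1)) *
        (ENNReal.ofReal ((l ^ 2) ^ |e0| * R ^ e0) * n + ENNReal.ofReal ((l ^ 2) ^ |e0| * (R / l) ^ e0) * n') := by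
        refine add_le_add le_rfl (mul_le_mul_right (add_le_add (mul_le_mul_left (ENNReal.ofReal_le_ofReal hw) _) (mul_le_mul_left (ENNReal.ofReal_le_ofReal ?_) _)) _)
        exact le_mul_of_one_le_left (by positivity) hone
    _ = _ := by
        rw [ENNReal.ofReal_mul (p := (l ^ 2) ^ |e0|) (by positivity), ENNReal.ofReal_mul (p := (l ^ 2) ^ |e0|) (by positivity),
          ENNReal.ofReal_mul (p := (1 - ε) ^ (1 - T) * (1 - l⁻¹)⁻¹ * 2 ^ (T - 1)) (by positivity)]; ring

lemma ckn_1d {s p q T a e0 e1 e2 Λ : ℝ} (hs : 0 < s) (hp : 1 < p) (hq : 1 ≤ q) (hT : 1 ≤ T)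
    (ha : 0 < a) (ha1 : a ≤ 1) (hΛ : 1 < Λ) (hκ : a * (1 / p - s) + (1 - a) / q ≤ 1 / T)
    (hsc : e0 + (1 / T - a * (1 / p - s) - (1 - a) / q) * T - e1 * (a * T / p) -
      e2 * ((1 - a) * T / q) = 0) (he : 0 < e0 + 1)
    (hPQ : 1 ≤ a * T / p + (1 - a) * T / q) :
    ∃ C : ℝ, 0 < C ∧ ∀ (f : ℝ → ℝ) (M R1 : ℝ), Measurable f → (∀ x, |f x| ≤ M) → 0 < R1 →
      (∀ r, R1 < r → f r = 0) →
      ∫⁻ r in Ioi 0, ENNReal.ofReal (r ^ e0) * ‖f r‖ₑ ^ T ≤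
        ENNReal.ofReal C *
        ((∫⁻ r in Ioi 0, ENNReal.ofReal (r ^ e1) * cknG s p f (Icc (Λ⁻¹ * r) (Λ * r)) r) ^ (a * T / p) *
          (∫⁻ r in Ioi 0, ENNReal.ofReal (r ^ e2) * ‖f r‖ₑ ^ q) ^ ((1 - a) * T / q)) := by
  have hT0 : 0 < T := by linarith
  have hp0 : 0 < p := by linarith
  have hq0 : 0 < q := by linarith
  have h1a : 0 ≤ 1 - a := by linarith
  have hΛ0 : 0 < Λ := by linarith
  obtain ⟨C, hC, hstep⟩ := ckn_step hs hp hq hT ha ha1 hΛ hκ hsc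
  set P := a * T / p with hP
  set Q := (1 - a) * T / q with hQ
  have hP0 : 0 ≤ P := by positivity
  have hQ0 : 0 ≤ Q := by positivity
  obtain ⟨l, hl, hl2⟩ : ∃ l : ℝ, 1 < l ∧ l ^ 2 = Λ :=
    ⟨√Λ, by rw [Real.lt_sqrt (by norm_num)]; simpa using hΛ, Real.sq_sqrt hΛ0.le⟩
  have hl0 : 0 < l := by linarith
  set ε := l ^ (-((e0 + 1) / T)) with hε
  have hε0 : 0 < ε := by positivity
  have hε1 : ε < 1 := Real.rpow_lt_one_of_one_lt_of_neg hl (by rw [neg_lt_zero]; positivity)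
  have hε2 : 0 < 1 - ε := by linarith
  have hl1 : 0 < 1 - l⁻¹ := by rw [sub_pos]; exact inv_lt_one_of_one_lt₀ hl
  set CA := Λ ^ |e0| * 2 ^ (T - 1) with hCA
  set CB := (1 - ε) ^ (1 - T) * (1 - l⁻¹)⁻¹ * 2 ^ (T - 1) * (l ^ 2) ^ |e0| with hCB
  have hCA0 : 0 < CA := by positivity
  have hCB0 : 0 < CB := by positivity
  refine ⟨CA * (1 + (1 - ε)⁻¹ * CB * 2) * C * 2 ^ P * 2 ^ Q, by positivity, ?_⟩
  intro f M R1 hf hM hR1 hsupp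
  set R0 := Λ * R1 with hR0d
  have hR0 : 0 < R0 := by positivity
  set R : ℕ → ℝ := fun j => R0 / l ^ j with hRd
  have hRpos : ∀ j, 0 < R j := fun j => by positivity
  have hR1' : ∀ j, R (j + 1) = R j / l := fun j => by simp only [hRd]; rw [pow_succ]; field_simp
  have hR2' : ∀ j, R (j + 2) = R j / Λ := fun j => by simp only [hRd]; rw [← hl2, pow_add]; field_simp
  have hanti : Antitone R := antitone_nat_of_succ_le fun j => by
    rw [hR1']; exact div_le_self (hRpos j).le hl.le
  set c : ℕ → ℝ := fun j => ⨍ y in Ioc (R j / Λ) (R j), f y with hc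
  set o : ℕ → ℝ≥0∞ := fun j => ENNReal.ofReal (R j ^ e0) * ∫⁻ r in Ioc (R j / Λ) (R j), ‖f r - c j‖ₑ ^ T with ho
  set v : ℕ → ℝ≥0∞ := fun j => ENNReal.ofReal (R j ^ (e0 + 1)) * ‖c j‖ₑ ^ T with hv
  set X := ∫⁻ r in Ioi 0, ENNReal.ofReal (r ^ e1) * cknG s p f (Icc (Λ⁻¹ * r) (Λ * r)) r
  set Y := ∫⁻ r in Ioi 0, ENNReal.ofReal (r ^ e2) * ‖f r‖ₑ ^ q
  have hosum : ∑' j, o j ≤ ENNReal.ofReal C * ((2 * X) ^ P * (2 * Y) ^ Q) := by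
    calc ∑' j, o j ≤ ∑' j, ENNReal.ofReal C *
        ((∫⁻ r in Ioc (R (j + 2)) (R j), ENNReal.ofReal (r ^ e1) * cknG s p f (Icc (Λ⁻¹ * r) (Λ * r)) r) ^ P *
          (∫⁻ r in Ioc (R (j + 2)) (R j), ENNReal.ofReal (r ^ e2) * ‖f r‖ₑ ^ q) ^ Q) := by
          apply ENNReal.tsum_le_tsum; intro j
          rw [hR2']
          exact hstep f M (R j) hf hM (hRpos j)
      _ ≤ _ := by
          rw [ENNReal.tsum_mul_left]
          refine mul_le_mul_right ((ckn_tsum_holder _ _ hP0 hQ0 hPQ).trans ?_) _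
          refine mul_le_mul' (ENNReal.rpow_le_rpow ?_ hP0) (ENNReal.rpow_le_rpow ?_ hQ0)
          · exact ckn_cover hanti hRpos _
          · exact ckn_cover hanti hRpos _
  have hv0 : v 0 = 0 := by
    have : c 0 = 0 := by
      simp only [hc]
      rw [setAverage_eq, setIntegral_eq_zero_of_forall_eq_zero, smul_zero]
      intro r hr
      apply hsupp
      have := hr.1
      simpa [hRd, hR0d, hΛ0.ne'] using this
    simp [hv, this, hT0]
  have hvs : ∀ j, v (j + 1) ≤ ENNReal.ofReal ε * v j + ENNReal.ofReal CB * (o j + o (j + 1)) := by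
    intro j
    have := ckn_tele hT he hl (hRpos j) hf (c j) (c (j + 1))
    rw [hl2, ← hR1'] at this
    simpa only [hv, ho, hCB, hl2] using this
  have hvsum := ckn_seq hε0.le hε1 hv0 hvs
  have hwsum : ∑' j, ENNReal.ofReal CB * (o j + o (j + 1)) ≤ ENNReal.ofReal CB * (2 * ∑' j, o j) := by
    rw [ENNReal.tsum_mul_left, ENNReal.tsum_add, two_mul]
    refine mul_le_mul_right (add_le_add le_rfl ?_) _
    exact ENNReal.tsum_comp_le_tsum_of_injective (add_left_injective 1) o
  have hA : ∀ j, ∫⁻ r in Ioc (R (j + 1)) (R j), ENNReal.ofReal (r ^ e0) * ‖f r‖ₑ ^ T ≤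
      ENNReal.ofReal CA * (o j + v j) := by
    intro j
    refine le_trans (lintegral_mono_set (Ioc_subset_Ioc ?_ le_rfl)) (ckn_pt hT hΛ (hRpos j) hf (c j))
    rw [← hR2']; exact hanti (by omega)
  have hcov : Ioi (0:ℝ) ⊆ (⋃ j, Ioc (R (j + 1)) (R j)) ∪ Ioi R0 := by
    intro r hr
    have hr0 : 0 < r := hr
    rcases le_or_gt r R0 with h | h
    · left
      obtain ⟨n, hn1, hn2⟩ := exists_nat_pow_near (x := R0 / r) (by rw [le_div_iff₀ hr0]; linarith) hl
      rw [mem_iUnion]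
      refine ⟨n, ?_, ?_⟩
      · simp only [hRd]
        rw [div_lt_iff₀ hr0] at hn2
        rw [div_lt_iff₀ (by positivity)]; linarith
      · simp only [hRd]
        rw [le_div_iff₀ hr0] at hn1
        rw [le_div_iff₀ (by positivity)]; linarith
    · right; exact h
  have hz : ∫⁻ r in Ioi R0, ENNReal.ofReal (r ^ e0) * ‖f r‖ₑ ^ T = 0 := by
    rw [setLIntegral_congr_fun (g := fun _ => 0) measurableSet_Ioi]
    · simp
    · intro r hr
      have : f r = 0 := hsupp r (lt_of_le_of_lt (by nlinarith) hr)
      simp [this, hT0]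
  calc _ ≤ ∫⁻ r in (⋃ j, Ioc (R (j + 1)) (R j)) ∪ Ioi R0, ENNReal.ofReal (r ^ e0) * ‖f r‖ₑ ^ T := lintegral_mono_set hcov
    _ ≤ (∫⁻ r in (⋃ j, Ioc (R (j + 1)) (R j)), ENNReal.ofReal (r ^ e0) * ‖f r‖ₑ ^ T) + 0 := by
        rw [← hz]; exact lintegral_union_le _ _ _
    _ ≤ ∑' j, ∫⁻ r in Ioc (R (j + 1)) (R j), ENNReal.ofReal (r ^ e0) * ‖f r‖ₑ ^ T := by
        rw [add_zero]; exact lintegral_iUnion_le _ _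
    _ ≤ ∑' j, ENNReal.ofReal CA * (o j + v j) := ENNReal.tsum_le_tsum hA
    _ = ENNReal.ofReal CA * (∑' j, o j + ∑' j, v j) := by rw [ENNReal.tsum_mul_left, ENNReal.tsum_add]
    _ ≤ ENNReal.ofReal CA * (∑' j, o j + ENNReal.ofReal (1 - ε)⁻¹ * (ENNReal.ofReal CB * (2 * ∑' j, o j))) := by
        refine mul_le_mul_right (add_le_add le_rfl (hvsum.trans ?_)) _
        exact mul_le_mul_right hwsum _
    _ = ENNReal.ofReal (CA * (1 + (1 - ε)⁻¹ * CB * 2)) * ∑' j, o j := by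
        rw [ENNReal.ofReal_mul (p := CA) hCA0.le, ENNReal.ofReal_add (by positivity) (by positivity),
          ENNReal.ofReal_mul (p := (1 - ε)⁻¹ * CB) (by positivity),
          ENNReal.ofReal_mul (p := (1 - ε)⁻¹) (by positivity), ENNReal.ofReal_one, ENNReal.ofReal_ofNat]
        ring
    _ ≤ ENNReal.ofReal (CA * (1 + (1 - ε)⁻¹ * CB * 2)) * (ENNReal.ofReal C * ((2 * X) ^ P * (2 * Y) ^ Q)) :=
        mul_le_mul_right hosum _
    _ = _ := by
        rw [ENNReal.mul_rpow_of_nonneg _ _ hP0, ENNReal.mul_rpow_of_nonneg _ _ hQ0,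
          ENNReal.ofReal_mul (p := CA * (1 + (1 - ε)⁻¹ * CB * 2) * C * 2 ^ P) (by positivity),
          ENNReal.ofReal_mul (p := CA * (1 + (1 - ε)⁻¹ * CB * 2) * C) (by positivity),
          ENNReal.ofReal_mul (p := CA * (1 + (1 - ε)⁻¹ * CB * 2)) (by positivity),
          ← ENNReal.ofReal_rpow_of_pos two_pos, ← ENNReal.ofReal_rpow_of_pos two_pos, ENNReal.ofReal_ofNat]
        ring

theorem ckn_polar {d : ℕ} (F : EuclideanSpace ℝ (Fin d) → ℝ≥0∞) (hd : 2 ≤ d) (hF : Measurable F) :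
    ∫⁻ x, F x = ∫⁻ ω, ∫⁻ r in Ioi (0:ℝ), ENNReal.ofReal (r ^ (d - 1)) * F (r • (ω : EuclideanSpace ℝ (Fin d)))
      ∂volume ∂(volume : Measure (EuclideanSpace ℝ (Fin d))).toSphere := by
  set μ := (volume : Measure (EuclideanSpace ℝ (Fin d)))
  have h1 : ∫⁻ x, F x ∂μ = ∫⁻ x : ({(0)}ᶜ : Set (EuclideanSpace ℝ (Fin d))), F x ∂(μ.comap (↑)) := by
    have : Nonempty (Fin d) := ⟨⟨0, by omega⟩⟩
    rw [lintegral_subtype_comap (measurableSet_singleton _).compl F, restrict_compl_singleton]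
  have hdim : Module.finrank ℝ (EuclideanSpace ℝ (Fin d)) = d := by simp
  have hmp := μ.measurePreserving_homeomorphUnitSphereProd
  rw [hdim] at hmp
  have hG : Measurable fun z : Metric.sphere (0 : EuclideanSpace ℝ (Fin d)) 1 × Ioi (0:ℝ) =>
      F ((z.2 : ℝ) • (z.1 : EuclideanSpace ℝ (Fin d))) := by
    apply hF.comp
    fun_prop
  have h2 := hmp.lintegral_comp hG
  have h3 : ∀ x : ({(0)}ᶜ : Set (EuclideanSpace ℝ (Fin d))), 
      F ((((homeomorphUnitSphereProd (EuclideanSpace ℝ (Fin d))) x).2 : ℝ) • (((homeomorphUnitSphereProd (EuclideanSpace ℝ (Fin d))) x).1 : EuclideanSpace ℝ (Fin d))) = F x := by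
    intro x
    congr 1
    have := (homeomorphUnitSphereProd (EuclideanSpace ℝ (Fin d))).symm_apply_apply x
    have h := congrArg Subtype.val this
    rwa [homeomorphUnitSphereProd_symm_apply_coe] at h
  simp only [h3] at h2
  rw [h1, h2, lintegral_prod _ hG.aemeasurable]
  refine lintegral_congr fun ω => ?_
  rw [Measure.volumeIoiPow, lintegral_withDensity_eq_lintegral_mul]
  · rw [← lintegral_subtype_comap measurableSet_Ioi]
    rfl
  · fun_prop
  · exact hG.comp (by fun_prop)

theorem ckn_radial {d : ℕ} (F : ℝ → ℝ≥0∞) (hd : 2 ≤ d) (hF : Measurable F) :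
    ∫⁻ x : EuclideanSpace ℝ (Fin d), F ‖x‖ = (volume : Measure (EuclideanSpace ℝ (Fin d))).toSphere univ *
      ∫⁻ r in Ioi (0:ℝ), ENNReal.ofReal (r ^ (d - 1)) * F r := by
  rw [ckn_polar (fun x => F ‖x‖) hd (hF.comp measurable_norm)]
  have : ∀ ω : Metric.sphere (0 : EuclideanSpace ℝ (Fin d)) 1, ∫⁻ r in Ioi (0:ℝ), ENNReal.ofReal (r ^ (d - 1)) * F ‖r • (ω : EuclideanSpace ℝ (Fin d))‖ = ∫⁻ r in Ioi (0:ℝ), ENNReal.ofReal (r ^ (d - 1)) * F r := by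
    intro ω
    refine setLIntegral_congr_fun measurableSet_Ioi fun r hr => ?_
    have : ‖r • (ω : EuclideanSpace ℝ (Fin d))‖ = r := by
      rw [norm_smul, norm_eq_of_mem_sphere, mul_one, Real.norm_of_nonneg (le_of_lt hr)]
    simp only [this]
  simp only [this, lintegral_const, mul_comm]

theorem ckn_cap {d : ℕ} (hd : 2 ≤ d) : ∃ c > (0:ℝ), ∀ ω₀ : Metric.sphere (0 : EuclideanSpace ℝ (Fin d)) 1,
    ∀ δ : ℝ, 0 < δ → δ ≤ 1 → ENNReal.ofReal (c * δ ^ (d - 1)) ≤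
      (volume : Measure (EuclideanSpace ℝ (Fin d))).toSphere {ω | ‖(ω : EuclideanSpace ℝ (Fin d)) - ω₀‖ ≤ δ} := by
  have : Nonempty (Fin d) := ⟨⟨0, by omega⟩⟩
  set E := EuclideanSpace ℝ (Fin d)
  set μ := (volume : Measure E) with hμ
  have hb : 0 < (μ (Metric.ball 0 1)).toReal :=
    ENNReal.toReal_pos (Metric.measure_ball_pos _ _ one_pos).ne' measure_ball_lt_top.ne
  refine ⟨(μ (Metric.ball 0 1)).toReal / (2 ^ d * 2 ^ (d - 1)), by positivity, fun ω₀ δ hδ hδ1 => ?_⟩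
  have h0 : ‖(ω₀ : E)‖ = 1 := norm_eq_of_mem_sphere ω₀
  set S := {ω : Metric.sphere (0 : E) 1 | ‖(ω : E) - ω₀‖ ≤ δ}
  have hS : MeasurableSet S := measurableSet_le (by fun_prop) measurable_const
  have key : μ (Metric.ball (ω₀:E) (δ/2)) ≤ ENNReal.ofReal (δ * 2 ^ (d-1)) * μ.toSphere S := by
    rw [← lintegral_indicator_one Metric.isOpen_ball.measurableSet,
      ckn_polar _ hd (measurable_one.indicator Metric.isOpen_ball.measurableSet)]
    calc _ ≤ ∫⁻ ω, S.indicator (fun _ => ENNReal.ofReal (δ * 2 ^ (d-1))) ω ∂μ.toSphere := by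
          refine lintegral_mono fun ω => ?_
          have h1 : ‖(ω : E)‖ = 1 := norm_eq_of_mem_sphere ω
          have hr : ∀ r ∈ Ioi (0:ℝ), (r • (ω:E)) ∈ Metric.ball (ω₀ : E) (δ/2) → |r - 1| < δ / 2 ∧ ω ∈ S := by
            intro r hr h
            rw [mem_ball_iff_norm] at h
            have h2 : |r - 1| < δ / 2 := by
              have := abs_norm_sub_norm_le (r • (ω:E)) (ω₀ : E)
              rw [norm_smul, h0, h1, mul_one, Real.norm_of_nonneg (le_of_lt hr)] at this
              exact this.trans_lt h
            refine ⟨h2, ?_⟩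
            show ‖(ω : E) - ω₀‖ ≤ δ
            have h3 : (ω : E) - ω₀ = (1 - r) • (ω:E) + (r • (ω:E) - ω₀) := by
              rw [sub_smul, one_smul]; abel
            rw [h3]
            refine (norm_add_le _ _).trans ?_
            rw [norm_smul, h1, mul_one, Real.norm_eq_abs, abs_sub_comm]
            linarith
          by_cases hω : ω ∈ S
          · rw [indicator_of_mem hω]
            calc _ ≤ ∫⁻ r in Ioi (0:ℝ), (Ioo (1 - δ/2) (1 + δ/2)).indicator (fun _ => ENNReal.ofReal (2^(d-1))) r := by
                  refine setLIntegral_mono' measurableSet_Ioi fun r hr0 => ?_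
                  by_cases hm : (r • (ω:E)) ∈ Metric.ball (ω₀ : E) (δ/2)
                  · have h2 := abs_lt.1 (hr r hr0 hm).1
                    rw [indicator_of_mem hm, indicator_of_mem (by constructor <;> linarith)]
                    simp only [Pi.one_apply, mul_one]
                    refine ENNReal.ofReal_le_ofReal (pow_le_pow_left₀ (le_of_lt hr0) (by linarith) _)
                  · rw [indicator_of_notMem hm, mul_zero]; exact zero_le
              _ ≤ ∫⁻ r, (Ioo (1 - δ/2) (1 + δ/2)).indicator (fun _ => ENNReal.ofReal (2^(d-1))) r :=
                  setLIntegral_le_lintegral _ _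
              _ = _ := by
                  rw [lintegral_indicator_const measurableSet_Ioo, Real.volume_Ioo,
                    ← ENNReal.ofReal_mul (by positivity)]
                  congr 1; ring
          · rw [indicator_of_notMem hω]
            refine le_of_eq ?_
            rw [← lintegral_zero (μ := volume.restrict (Ioi (0:ℝ)))]
            refine setLIntegral_congr_fun measurableSet_Ioi fun r hr0 => ?_
            rw [indicator_of_notMem (fun hm => hω (hr r hr0 hm).2), mul_zero]
      _ = _ := by rw [lintegral_indicator_const hS]
  have hball : μ (Metric.ball (ω₀:E) (δ/2)) = ENNReal.ofReal ((δ/2)^d) * μ (Metric.ball 0 1) := by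
    rw [Measure.addHaar_ball_of_pos _ _ (by positivity)]; simp [E]
  rw [hball, ← ENNReal.ofReal_toReal (a := μ (Metric.ball 0 1)) measure_ball_lt_top.ne, ← ENNReal.ofReal_mul (by positivity)] at key
  have hpos : 0 < δ * 2 ^ (d-1) := by positivity
  rw [← ENNReal.mul_le_mul_iff_right (a := ENNReal.ofReal (δ * 2 ^ (d-1))) (by simpa using hpos) ENNReal.ofReal_ne_top]
  refine le_trans (le_of_eq ?_) key
  rw [← ENNReal.ofReal_mul hpos.le]
  congr 1
  obtain ⟨k, rfl⟩ : ∃ k, d = k + 1 := ⟨d - 1, by omega⟩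
  simp only [Nat.add_sub_cancel]
  rw [div_pow, pow_succ]
  field_simp
  ring

theorem ckn_kernel {d : ℕ} (hd : 2 ≤ d) {θ Λ : ℝ} (hθ : 0 < θ) (hΛ : 1 < Λ) : ∃ c > (0:ℝ),
    ∀ (H : ℝ → ℝ≥0∞) (x : EuclideanSpace ℝ (Fin d)), Measurable H → x ≠ 0 →
    (∀ t, ¬ (Λ⁻¹ * ‖x‖ ≤ t ∧ t ≤ Λ * ‖x‖) → H t = 0) →
    ENNReal.ofReal c * ∫⁻ t in Ioi (0:ℝ), H t * ENNReal.ofReal (1 / |‖x‖ - t| ^ (1 + θ)) ≤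
      ∫⁻ y : EuclideanSpace ℝ (Fin d), H ‖y‖ * ENNReal.ofReal (1 / ‖x - y‖ ^ ((d:ℝ) + θ)) := by
  obtain ⟨c, hc, hcap⟩ := ckn_cap hd
  refine ⟨c * (Λ ^ (d - 1))⁻¹ * (2 ^ ((d:ℝ) + θ))⁻¹, by positivity, fun H x hH hx hH0 => ?_⟩
  set μ := (volume : Measure (EuclideanSpace ℝ (Fin d))) with hμ
  have hr : 0 < ‖x‖ := norm_pos_iff.2 hx
  set r := ‖x‖ with hrd
  set ω₀ : Metric.sphere (0 : EuclideanSpace ℝ (Fin d)) 1 := ⟨r⁻¹ • x, by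
    rw [mem_sphere_zero_iff_norm, norm_smul, norm_inv, norm_norm, inv_mul_cancel₀ hr.ne']⟩ with hω
  have hxω : x = r • (ω₀ : EuclideanSpace ℝ (Fin d)) := by rw [hω]; simp only [smul_smul]; rw [mul_inv_cancel₀ hr.ne', one_smul]
  have hn : ∀ (ω : Metric.sphere (0 : EuclideanSpace ℝ (Fin d)) 1) (t : ℝ), 0 < t → ‖t • (ω : EuclideanSpace ℝ (Fin d))‖ = t := fun ω t ht => by
    rw [norm_smul, norm_eq_of_mem_sphere, mul_one, Real.norm_of_nonneg ht.le]
  have hmK : Measurable fun y : EuclideanSpace ℝ (Fin d) => ENNReal.ofReal (1 / ‖x - y‖ ^ ((d:ℝ) + θ)) := by fun_prop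
  rw [ckn_polar (fun y => H ‖y‖ * ENNReal.ofReal (1 / ‖x - y‖ ^ ((d:ℝ) + θ))) hd ((hH.comp measurable_norm).mul hmK), lintegral_lintegral_swap]
  swap
  · refine Measurable.aemeasurable ?_
    refine Measurable.mul (by fun_prop) (Measurable.mul ?_ ?_)
    · exact hH.comp (by fun_prop)
    · exact hmK.comp (by fun_prop)
  rw [← lintegral_const_mul']
  swap
  · exact ENNReal.ofReal_ne_top
  refine setLIntegral_mono' measurableSet_Ioi fun t ht => ?_
  have ht : 0 < t := ht
  by_cases hcut : Λ⁻¹ * r ≤ t ∧ t ≤ Λ * r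
  swap
  · rw [hH0 t hcut]; simp
  by_cases hrt : t = r
  · subst hrt; rw [sub_self, abs_zero, Real.zero_rpow (by positivity)]; simp
  set D := |r - t| with hD
  have hDpos : 0 < D := abs_pos.2 (sub_ne_zero.2 (Ne.symm hrt))
  have hΛ0 : 0 < Λ := by linarith
  have hDt : D ≤ Λ * t := by
    have h1 : r ≤ Λ * t := by
      have := hcut.1
      rwa [inv_mul_le_iff₀ hΛ0] at this
    rw [hD, abs_le]; constructor
    · nlinarith
    · nlinarith
  set δ := D / (Λ * t) with hδ
  have hδ0 : 0 < δ := by positivity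
  have hδ1 : δ ≤ 1 := by rw [hδ, div_le_one (by positivity)]; exact hDt
  have htδ : t * δ ≤ D := by
    have : t * δ = D / Λ := by rw [hδ]; field_simp
    rw [this]; exact div_le_self hDpos.le hΛ.le
  have hcap' := hcap ω₀ δ hδ0 hδ1
  set S := {ω : Metric.sphere (0 : EuclideanSpace ℝ (Fin d)) 1 | ‖(ω : EuclideanSpace ℝ (Fin d)) - ω₀‖ ≤ δ}
  have hS : MeasurableSet S := measurableSet_le (by fun_prop) measurable_const
  calc _ = ENNReal.ofReal (t^(d-1)) * (H t * (ENNReal.ofReal (1 / (2 * D) ^ ((d:ℝ) + θ)) * ENNReal.ofReal (c * δ ^ (d - 1)))) := by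
        have e1 : c * (Λ ^ (d - 1))⁻¹ * (2 ^ ((d:ℝ) + θ))⁻¹ * (1 / D ^ (1 + θ)) = t^(d-1) * (1 / (2 * D) ^ ((d:ℝ) + θ) * (c * δ ^ (d - 1))) := by
          have h1 : D ^ ((d:ℝ) + θ) = D ^ (d - 1) * D ^ (1 + θ) := by
            rw [← Real.rpow_natCast, ← Real.rpow_add hDpos, Nat.cast_sub (by omega)]
            congr 1; push_cast; ring
          rw [Real.mul_rpow zero_le_two hDpos.le, h1, hδ, div_pow, mul_pow]
          field_simp
        have e2 := congrArg ENNReal.ofReal e1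
        rw [ENNReal.ofReal_mul (p := c * (Λ ^ (d - 1))⁻¹ * (2 ^ ((d:ℝ) + θ))⁻¹) (by positivity),
          ENNReal.ofReal_mul (p := t ^ (d-1)) (by positivity),
          ENNReal.ofReal_mul (p := 1 / (2 * D) ^ ((d:ℝ) + θ)) (by positivity)] at e2
        rw [mul_left_comm, e2]
        ring
    _ ≤ ENNReal.ofReal (t^(d-1)) * (H t * (ENNReal.ofReal (1 / (2 * D) ^ ((d:ℝ) + θ)) * μ.toSphere S)) := by
        gcongr
    _ = ∫⁻ ω in S, ENNReal.ofReal (t^(d-1)) * (H t * ENNReal.ofReal (1 / (2 * D) ^ ((d:ℝ) + θ))) ∂μ.toSphere := by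
        rw [setLIntegral_const]; ring
    _ ≤ ∫⁻ ω in S, ENNReal.ofReal (t^(d-1)) * (H ‖t • (ω:EuclideanSpace ℝ (Fin d))‖ * ENNReal.ofReal (1 / ‖x - t • (ω:EuclideanSpace ℝ (Fin d))‖ ^ ((d:ℝ) + θ))) ∂μ.toSphere := by
        refine setLIntegral_mono' hS fun ω hω => ?_
        rw [hn ω t ht]
        have hle : ‖x - t • (ω:EuclideanSpace ℝ (Fin d))‖ ≤ 2 * D := by
          have : x - t • (ω:EuclideanSpace ℝ (Fin d)) = (r - t) • (ω₀:EuclideanSpace ℝ (Fin d)) + t • ((ω₀:EuclideanSpace ℝ (Fin d)) - ω) := by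
            conv_lhs => rw [hxω]
            rw [sub_smul, smul_sub]; abel
          rw [this]
          refine (norm_add_le _ _).trans ?_
          rw [norm_smul (r - t), norm_smul t, norm_eq_of_mem_sphere ω₀, Real.norm_eq_abs, Real.norm_of_nonneg ht.le, norm_sub_rev]
          have h2 : ‖(ω:EuclideanSpace ℝ (Fin d)) - ω₀‖ ≤ δ := hω
          nlinarith
        have hge : 0 < ‖x - t • (ω:EuclideanSpace ℝ (Fin d))‖ := by
          have := abs_norm_sub_norm_le x (t • (ω:EuclideanSpace ℝ (Fin d)))
          rw [hn ω t ht] at this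
          exact hDpos.trans_le this
        gcongr
    _ ≤ _ := setLIntegral_le_lintegral _ _

theorem ckn_trunc_lip (M a b : ℝ) : |max (min a M) (-M) - max (min b M) (-M)| ≤ |a - b| := by
  refine (abs_max_sub_max_le_abs _ _ _).trans ?_
  have := abs_min_sub_min_le_max a M b M
  simpa using this

theorem ckn_trunc_abs (M a : ℝ) (hM : 0 ≤ M) : |max (min a M) (-M)| ≤ |a| := by
  have := ckn_trunc_lip M a 0
  simpa [hM] using this

theorem ckn_1d_unb {s p q T a e0 e1 e2 Λ : ℝ} (hs : 0 < s) (hp : 1 < p) (hq : 1 ≤ q) (hT : 1 ≤ T)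
    (ha : 0 < a) (ha1 : a ≤ 1) (hΛ : 1 < Λ) (hκ : a * (1 / p - s) + (1 - a) / q ≤ 1 / T)
    (hsc : e0 + (1 / T - a * (1 / p - s) - (1 - a) / q) * T - e1 * (a * T / p) - e2 * ((1 - a) * T / q) = 0)
    (he : 0 < e0 + 1) (hPQ : 1 ≤ a * T / p + (1 - a) * T / q) :
    ∃ C : ℝ, 0 < C ∧ ∀ (f : ℝ → ℝ) (R1 : ℝ), Measurable f → 0 < R1 → (∀ r, R1 < r → f r = 0) →
      ∫⁻ r in Ioi (0:ℝ), ENNReal.ofReal (r ^ e0) * ‖f r‖ₑ ^ T ≤ ENNReal.ofReal C *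
        ((∫⁻ r in Ioi (0:ℝ), ENNReal.ofReal (r ^ e1) * cknG s p f (Icc (Λ⁻¹ * r) (Λ * r)) r) ^ (a * T / p) *
         (∫⁻ r in Ioi (0:ℝ), ENNReal.ofReal (r ^ e2) * ‖f r‖ₑ ^ q) ^ ((1 - a) * T / q)) := by
  obtain ⟨C, hC, h⟩ := ckn_1d (e0 := e0) (e1 := e1) (e2 := e2) hs hp hq hT ha ha1 hΛ hκ hsc he hPQ
  refine ⟨C, hC, fun f R1 hf hR1 hsupp => ?_⟩
  set g : ℕ → ℝ → ℝ := fun n x => max (min (f x) n) (-n) with hg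
  have hgm : ∀ n, Measurable (g n) := fun n => by simp only [hg]; fun_prop
  have hp0 : 0 ≤ p := by linarith
  have hq0 : 0 ≤ q := by linarith
  have hgn : ∀ n x, ‖g n x‖ₑ ≤ ‖f x‖ₑ := fun n x => by
    rw [Real.enorm_eq_ofReal_abs, Real.enorm_eq_ofReal_abs]
    exact ENNReal.ofReal_le_ofReal (ckn_trunc_abs _ _ (Nat.cast_nonneg n))
  have hgd : ∀ n x y, ‖g n x - g n y‖ₑ ≤ ‖f x - f y‖ₑ := fun n x y => by
    rw [Real.enorm_eq_ofReal_abs, Real.enorm_eq_ofReal_abs]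
    exact ENNReal.ofReal_le_ofReal (ckn_trunc_lip _ _ _)
  have hP0 : 0 ≤ a * T / p := by positivity
  have hQ0 : 0 ≤ (1 - a) * T / q := div_nonneg (mul_nonneg (by linarith) (by linarith)) hq0
  have hn : ∀ n : ℕ, ∫⁻ r in Ioi (0:ℝ), ENNReal.ofReal (r ^ e0) * ‖g n r‖ₑ ^ T ≤ ENNReal.ofReal C *
        ((∫⁻ r in Ioi (0:ℝ), ENNReal.ofReal (r ^ e1) * cknG s p f (Icc (Λ⁻¹ * r) (Λ * r)) r) ^ (a * T / p) *
         (∫⁻ r in Ioi (0:ℝ), ENNReal.ofReal (r ^ e2) * ‖f r‖ₑ ^ q) ^ ((1 - a) * T / q)) := by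
    intro n
    refine (h (g n) n R1 (hgm n) (fun x => ?_) hR1 (fun r hr => ?_)).trans ?_
    · rw [abs_le]; exact ⟨le_max_right _ _, max_le (min_le_right _ _) (by linarith [Nat.cast_nonneg (α := ℝ) n])⟩
    · simp [hg, hsupp r hr]
    · refine mul_le_mul_right (mul_le_mul' (ENNReal.rpow_le_rpow ?_ hP0) (ENNReal.rpow_le_rpow ?_ hQ0)) _
      · refine lintegral_mono fun r => mul_le_mul_right ?_ _
        refine lintegral_mono fun y => ?_
        exact ENNReal.div_le_div_right (ENNReal.rpow_le_rpow (hgd n r y) hp0) _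
      · refine lintegral_mono fun r => mul_le_mul_right ?_ _
        exact ENNReal.rpow_le_rpow (hgn n r) hq0
  have hlim : ∀ r, Filter.liminf (fun n => ENNReal.ofReal (r ^ e0) * ‖g n r‖ₑ ^ T) Filter.atTop = ENNReal.ofReal (r ^ e0) * ‖f r‖ₑ ^ T := by
    intro r
    refine Filter.Tendsto.liminf_eq (tendsto_const_nhds.congr' ?_)
    obtain ⟨N, hN⟩ := exists_nat_ge |f r|
    filter_upwards [Filter.eventually_ge_atTop N] with n hn
    have h1 : |f r| ≤ n := hN.trans (Nat.cast_le.2 hn)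
    have : g n r = f r := by
      simp only [hg]
      rw [min_eq_left ((le_abs_self _).trans h1), max_eq_left (by linarith [neg_abs_le (f r)])]
    rw [this]
  calc _ = ∫⁻ r in Ioi (0:ℝ), Filter.liminf (fun n => ENNReal.ofReal (r ^ e0) * ‖g n r‖ₑ ^ T) Filter.atTop := by
        simp only [hlim]
    _ ≤ Filter.liminf (fun n => ∫⁻ r in Ioi (0:ℝ), ENNReal.ofReal (r ^ e0) * ‖g n r‖ₑ ^ T) Filter.atTop :=
        lintegral_liminf_le fun n => by
          have := hgm n
          fun_prop
    _ ≤ _ := Filter.liminf_le_of_frequently_le' (Filter.Frequently.of_forall hn)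

theorem ckn_W {d : ℕ} (hd : 2 ≤ d) {γ τ : ℝ} (hτ : 1 ≤ τ) {f : ℝ → ℝ} (hf : Measurable f) :
    ∫⁻ x : EuclideanSpace ℝ (Fin d), ENNReal.ofReal (‖x‖ ^ (γ * τ) * |f ‖x‖| ^ τ) =
      (volume : Measure (EuclideanSpace ℝ (Fin d))).toSphere univ *
      ∫⁻ r in Ioi (0:ℝ), ENNReal.ofReal (r ^ (γ * τ + d - 1)) * ‖f r‖ₑ ^ τ := by
  rw [ckn_radial (fun r => ENNReal.ofReal (r ^ (γ * τ) * |f r| ^ τ)) hd (by fun_prop)]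
  congr 1
  refine setLIntegral_congr_fun measurableSet_Ioi fun r hr => ?_
  have hr : 0 < r := hr
  have h1 : r ^ (γ * τ + d - 1) = r ^ (d - 1) * r ^ (γ * τ) := by
    rw [← Real.rpow_natCast, ← Real.rpow_add hr, Nat.cast_sub (by omega)]
    congr 1; push_cast; ring
  rw [h1, ENNReal.ofReal_mul (p := r ^ (d - 1)) (by positivity), ENNReal.ofReal_mul (p := r ^ (γ * τ)) (by positivity),
    Real.enorm_eq_ofReal_abs, ENNReal.ofReal_rpow_of_nonneg (abs_nonneg _) (by linarith), mul_assoc]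

theorem ckn_cknG_meas {s p Λ : ℝ} {f : ℝ → ℝ} (hf : Measurable f) :
    Measurable fun r => cknG s p f (Icc (Λ⁻¹ * r) (Λ * r)) r := by
  have h1 : ∀ r, cknG s p f (Icc (Λ⁻¹ * r) (Λ * r)) r = ∫⁻ y, {z : ℝ × ℝ | Λ⁻¹ * z.1 ≤ z.2 ∧ z.2 ≤ Λ * z.1}.indicator
      (fun z => ‖f z.1 - f z.2‖ₑ ^ p / ENNReal.ofReal (|z.1 - z.2| ^ (1 + s * p))) (r, y) := by
    intro r
    rw [cknG, ← lintegral_indicator measurableSet_Icc]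
    rfl
  simp only [h1]
  refine Measurable.lintegral_prod_right' ?_
  refine Measurable.indicator (by fun_prop) ?_
  exact (measurableSet_le (f := fun z : ℝ × ℝ => Λ⁻¹ * z.1) (g := fun z => z.2) (by fun_prop) (by fun_prop)).inter
    (measurableSet_le (f := fun z : ℝ × ℝ => z.2) (g := fun z => Λ * z.1) (by fun_prop) (by fun_prop))

theorem ckn_TG {d : ℕ} (hd : 2 ≤ d) {s p α Λ : ℝ} (hs : 0 < s) (hp : 1 < p) (hΛ : 1 < Λ) : ∃ c > (0:ℝ),
    ∀ f : ℝ → ℝ, Measurable f → ENNReal.ofReal c * 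
      ∫⁻ r in Ioi (0:ℝ), ENNReal.ofReal (r ^ (α * p + d - 1)) * cknG s p f (Icc (Λ⁻¹ * r) (Λ * r)) r ≤
      ∫⁻ x : EuclideanSpace ℝ (Fin d), ∫⁻ y : EuclideanSpace ℝ (Fin d),
      ENNReal.ofReal (|f ‖x‖ - f ‖y‖| ^ p * ‖x‖ ^ (α * p) *
        chiCut Λ ‖x‖ ‖y‖ / ‖x - y‖ ^ ((d : ℝ) + s * p)) := by
  obtain ⟨c, hc, h⟩ := ckn_kernel hd (θ := s * p) (Λ := Λ) (by positivity) hΛ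
  have : Nonempty (Fin d) := ⟨⟨0, by omega⟩⟩
  set κ := (volume : Measure (EuclideanSpace ℝ (Fin d))).toSphere univ with hκ
  have hκ0 : κ ≠ 0 := by
    rw [hκ, Measure.measure_univ_ne_zero]; exact Measure.toSphere_ne_zero _
  have hκt : κ ≠ ⊤ := measure_ne_top _ _
  have hκr : 0 < κ.toReal := ENNReal.toReal_pos hκ0 hκt
  refine ⟨κ.toReal * c, by positivity, fun f hf => ?_⟩
  rw [ENNReal.ofReal_mul hκr.le, ENNReal.ofReal_toReal hκt]
  have hm := ckn_cknG_meas (s := s) (p := p) (Λ := Λ) hf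
  calc _ = κ * ∫⁻ r in Ioi (0:ℝ), ENNReal.ofReal (r ^ (d - 1)) * (ENNReal.ofReal c * (ENNReal.ofReal (r ^ (α * p)) * cknG s p f (Icc (Λ⁻¹ * r) (Λ * r)) r)) := by
        rw [mul_assoc, ← lintegral_const_mul' _ _ ENNReal.ofReal_ne_top]
        congr 1
        refine setLIntegral_congr_fun measurableSet_Ioi fun r hr => ?_
        have hr : 0 < r := hr
        have h1 : r ^ (α * p + d - 1) = r ^ (d - 1) * r ^ (α * p) := by
          rw [← Real.rpow_natCast, ← Real.rpow_add hr, Nat.cast_sub (by omega)]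
          congr 1; push_cast; ring
        rw [h1, ENNReal.ofReal_mul (p := r ^ (d - 1)) (by positivity)]
        generalize cknG s p f (Icc (Λ⁻¹ * r) (Λ * r)) r = z
        ring
    _ = ∫⁻ x : EuclideanSpace ℝ (Fin d), ENNReal.ofReal c * (ENNReal.ofReal (‖x‖ ^ (α * p)) * cknG s p f (Icc (Λ⁻¹ * ‖x‖) (Λ * ‖x‖)) ‖x‖) := by
        rw [ckn_radial (fun r => ENNReal.ofReal c * (ENNReal.ofReal (r ^ (α * p)) * cknG s p f (Icc (Λ⁻¹ * r) (Λ * r)) r)) hd (by fun_prop)]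
    _ ≤ _ := by
        refine lintegral_mono_ae ?_
        have hne : ∀ᵐ x : EuclideanSpace ℝ (Fin d), x ≠ 0 := by
          rw [ae_iff]; simp
        filter_upwards [hne] with x hx
        have hr : 0 < ‖x‖ := norm_pos_iff.2 hx
        set r := ‖x‖ with hrd
        set H : ℝ → ℝ≥0∞ := fun t => (Icc (Λ⁻¹ * r) (Λ * r)).indicator (fun t => ENNReal.ofReal (|f r - f t| ^ p * r ^ (α * p))) t with hH
        have hHm : Measurable H := Measurable.indicator (by fun_prop) measurableSet_Icc
        have hk := h H x hHm hx (fun t ht => indicator_of_notMem (s := Icc (Λ⁻¹ * r) (Λ * r)) ht _)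
        refine le_trans ?_ (hk.trans (le_of_eq ?_))
        · refine mul_le_mul_right ?_ _
          calc _ = ∫⁻ t in Icc (Λ⁻¹ * r) (Λ * r), ENNReal.ofReal (r ^ (α * p)) * (‖f r - f t‖ₑ ^ p / ENNReal.ofReal (|r - t| ^ (1 + s * p))) := by
                rw [cknG, lintegral_const_mul' _ _ ENNReal.ofReal_ne_top]
            _ = ∫⁻ t in Icc (Λ⁻¹ * r) (Λ * r), H t * ENNReal.ofReal (1 / |r - t| ^ (1 + s * p)) := by
                refine setLIntegral_congr_fun_ae measurableSet_Icc ?_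
                have hne2 : ∀ᵐ t : ℝ, t ≠ r := by rw [ae_iff]; simp
                filter_upwards [hne2] with t ht hmem
                have hD : 0 < |r - t| := abs_pos.2 (sub_ne_zero.2 (Ne.symm ht))
                rw [hH]; simp only []
                rw [indicator_of_mem hmem, Real.enorm_eq_ofReal_abs, ENNReal.ofReal_rpow_of_nonneg (abs_nonneg _) (by linarith),
                  ← ENNReal.ofReal_div_of_pos (by positivity), ← ENNReal.ofReal_mul (by positivity), ← ENNReal.ofReal_mul (by positivity)]
                congr 1; ring
            _ ≤ _ := by
                refine lintegral_mono_set fun t ht => ?_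
                exact lt_of_lt_of_le (by positivity) ht.1
        · refine lintegral_congr fun y => ?_
          rw [hH]; simp only []
          by_cases hmem : ‖y‖ ∈ Icc (Λ⁻¹ * r) (Λ * r)
          · rw [indicator_of_mem hmem, chiCut, if_pos (mem_Icc.1 hmem), ← ENNReal.ofReal_mul (by positivity)]
            congr 1; ring
          · rw [indicator_of_notMem hmem, chiCut, if_neg (fun h2 => hmem (mem_Icc.2 h2))]; simp

theorem ckn_null {d : ℕ} (hd : 2 ≤ d) {Z : Set ℝ} (hZ : MeasurableSet Z) (h0 : ∀ᵐ r ∂(volume.restrict (Ioi (0:ℝ))), r ∉ Z) :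
    ∀ᵐ x : EuclideanSpace ℝ (Fin d), ‖x‖ ∉ Z := by
  have h := ckn_radial (d := d) (Z.indicator 1) hd (measurable_one.indicator hZ)
  have h2 : ∫⁻ r in Ioi (0:ℝ), ENNReal.ofReal (r ^ (d - 1)) * Z.indicator 1 r = 0 := by
    refine lintegral_eq_zero_of_ae_eq_zero ?_
    filter_upwards [h0] with r hr
    simp [hr]
  rw [h2, mul_zero] at h
  replace h := (lintegral_eq_zero_iff ((measurable_one.indicator hZ).comp measurable_norm)).1 h
  filter_upwards [h] with x hx hxZ
  simp [hxZ] at hx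

theorem ckn_meas {d : ℕ} (hd : 2 ≤ d) {u : EuclideanSpace ℝ (Fin d) → ℝ}
    (hrad : ∀ x y : EuclideanSpace ℝ (Fin d), ‖x‖ = ‖y‖ → u x = u y)
    (hloc : LocallyIntegrableOn u {(0 : EuclideanSpace ℝ (Fin d))}ᶜ volume)
    (hcs : HasCompactSupport u) : ∃ (f : ℝ → ℝ) (R1 : ℝ), Measurable f ∧ 0 < R1 ∧ (∀ r, R1 < r → f r = 0) ∧
      ∀ᵐ x, u x = f ‖x‖ := by
  have : Nonempty (Fin d) := ⟨⟨0, by omega⟩⟩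
  have hm := hloc.aestronglyMeasurable
  rw [restrict_compl_singleton] at hm
  obtain ⟨R, hR⟩ := hcs.isCompact.isBounded.subset_closedBall 0
  have hR' : ∀ x, R < ‖x‖ → u x = 0 := by
    intro x hx
    by_contra hne
    have := hR (subset_tsupport u hne)
    rw [mem_closedBall_zero_iff] at this
    linarith
  set v := hm.mk u
  have hv : Measurable v := hm.stronglyMeasurable_mk.measurable
  have huv : ∀ᵐ x, u x = v x := hm.ae_eq_mk
  obtain ⟨N, hsub, hNm, hN0⟩ := exists_measurable_superset_of_null (ae_iff.1 huv)
  have hpol := ckn_polar (N.indicator 1) hd (measurable_one.indicator hNm)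
  rw [lintegral_indicator_one hNm, hN0] at hpol
  have hmeas : Measurable fun z : Metric.sphere (0 : EuclideanSpace ℝ (Fin d)) 1 × ℝ =>
      ENNReal.ofReal (z.2 ^ (d - 1)) * N.indicator (1 : EuclideanSpace ℝ (Fin d) → ℝ≥0∞) (z.2 • (z.1 : EuclideanSpace ℝ (Fin d))) := by
    refine Measurable.mul (by fun_prop) ((measurable_one.indicator hNm).comp (by fun_prop))
  have hpol2 := (lintegral_eq_zero_iff (hmeas.lintegral_prod_right' (ν := volume.restrict (Ioi (0:ℝ))))).1 hpol.symm
  have hne : NeZero (volume : Measure (EuclideanSpace ℝ (Fin d))).toSphere := ⟨Measure.toSphere_ne_zero _⟩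
  obtain ⟨ω, hω⟩ := hpol2.exists
  have hω2 := (lintegral_eq_zero_iff (hmeas.comp (measurable_prodMk_left (x := ω)))).1 hω
  have hω3 : ∀ᵐ r ∂(volume.restrict (Ioi (0:ℝ))), u (r • (ω : EuclideanSpace ℝ (Fin d))) = v (r • (ω : EuclideanSpace ℝ (Fin d))) := by
    filter_upwards [hω2, ae_restrict_mem measurableSet_Ioi] with r h1 h2
    have h2 : 0 < r := h2
    by_contra hcon
    have hmem : r • (ω : EuclideanSpace ℝ (Fin d)) ∈ N := hsub hcon
    simp [hmem] at h1
    have h3 : 0 < r ^ (d - 1) := by positivity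
    linarith
  have hg : ∀ x, u x = u (‖x‖ • (ω : EuclideanSpace ℝ (Fin d))) := fun x => hrad _ _ (by
    rw [norm_smul, norm_eq_of_mem_sphere, mul_one, norm_norm])
  obtain ⟨Z, hZsub, hZm, hZ0⟩ := exists_measurable_superset_of_null (ae_iff.1 hω3)
  refine ⟨(Iic (max R 1)).indicator fun r => v (r • (ω : EuclideanSpace ℝ (Fin d))), max R 1,
    (hv.comp (by fun_prop)).indicator measurableSet_Iic, by positivity,
    fun r hr => indicator_of_notMem (by simpa using hr) _, ?_⟩
  have hnull := ckn_null (d := d) hd hZm (by rw [ae_iff]; simpa using hZ0)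
  have key : ∀ x : EuclideanSpace ℝ (Fin d), ‖x‖ ∉ Z → u x = v (‖x‖ • (ω : EuclideanSpace ℝ (Fin d))) := by
    intro x hx
    rw [hg x]
    by_contra hcon
    exact hx (hZsub hcon)
  filter_upwards [hnull] with x hx
  by_cases h : ‖x‖ ≤ max R 1
  · rw [indicator_of_mem (by simpa using h), key x hx]
  · rw [indicator_of_notMem (by simpa using h)]
    exact hR' x (lt_of_le_of_lt (le_max_left _ _) (not_le.1 h))



theorem fractional_CKN_radial
    (d : ℕ) (s p q τ a α β γ σ Λ : ℝ) (hd : 2 ≤ d)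
    (hs : 0 < s) (hs1 : s < 1) (hp : 1 < p) (hq : 1 ≤ q) (hτ : 1 ≤ τ)
    (ha : 0 < a) (ha1 : a ≤ 1) (hΛ : 1 < Λ)
    (hσ : γ = a * σ + (1 - a) * β)
    (hbal : 1 / τ + γ / d = a * (1 / p + (α - s) / d) + (1 - a) * (1 / q + β / d))
    (hlow : -((d : ℝ) - 1) * s ≤ α - σ) (hupp : α - σ < 0)
    (hpos : 0 < 1 / τ + γ / d) :
    ∃ C > (0 : ℝ), ∀ u : EuclideanSpace ℝ (Fin d) → ℝ,
      (∀ x y : EuclideanSpace ℝ (Fin d), ‖x‖ = ‖y‖ → u x = u y) →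
      LocallyIntegrableOn u {(0 : EuclideanSpace ℝ (Fin d))}ᶜ volume →
      HasCompactSupport u →
      weightedLnorm d γ τ u ≤
        ENNReal.ofReal C * (truncGagliardo d s p α Λ u) ^ a *
          (weightedLnorm d β q u) ^ (1 - a) := by
  have hd0 : (0:ℝ) < d := by exact_mod_cast (by omega : 0 < d)
  have hp0 : 0 < p := by linarith
  have hq0 : 0 < q := by linarith
  have hτ0 : 0 < τ := by linarith
  have hbal1 : 1 / τ = a * (1 / p + (α - s - σ) / d) + (1 - a) / q := by
    have : γ / d = a * (σ / d) + (1 - a) * (β / d) := by rw [hσ]; ring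
    rw [this] at hbal
    have e : a * (1 / p + (α - s - σ) / d) + (1 - a) / q = a * (1 / p + (α - s) / d) + (1 - a) * (1 / q + β / d) - (a * (σ / d) + (1 - a) * (β / d)) := by ring
    linarith
  have hκ : a * (1 / p - s) + (1 - a) / q ≤ 1 / τ := by
    rw [hbal1]
    have h1 : -s ≤ (α - s - σ) / d := by
      rw [le_div_iff₀ hd0]; nlinarith
    have h2 := mul_le_mul_of_nonneg_left h1 ha.le
    nlinarith
  have hPQ : 1 ≤ a * τ / p + (1 - a) * τ / q := by
    have h1 : (α - s - σ) / d ≤ 0 := div_nonpos_of_nonpos_of_nonneg (by linarith) hd0.le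
    have h2 : 1 / τ ≤ a / p + (1 - a) / q := by
      rw [hbal1]
      have := mul_nonpos_of_nonneg_of_nonpos ha.le h1
      have e : a * (1 / p + (α - s - σ) / d) = a / p + a * ((α - s - σ) / d) := by ring
      rw [e]; linarith
    have h3 := mul_le_mul_of_nonneg_right h2 hτ0.le
    rw [one_div_mul_cancel hτ0.ne'] at h3
    have e : (a / p + (1 - a) / q) * τ = a * τ / p + (1 - a) * τ / q := by ring
    linarith
  have he : 0 < (γ * τ + d - 1) + 1 := by
    have : (1 / τ + γ / d) * (τ * d) = d + γ * τ := by field_simp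
    have h2 := mul_pos hpos (mul_pos hτ0 hd0)
    linarith
  have hsc : (γ * τ + d - 1) + (1 / τ - a * (1 / p - s) - (1 - a) / q) * τ - (α * p + d - 1) * (a * τ / p)
      - (β * q + d - 1) * ((1 - a) * τ / q) = 0 := by
    have h1 : (1 / τ + γ / d) * (τ * d) = (a * (1 / p + (α - s) / d) + (1 - a) * (1 / q + β / d)) * (τ * d) := by rw [hbal]
    have e1 : (1 / τ + γ / d) * (τ * d) = d + γ * τ := by field_simp
    have e2 : (a * (1 / p + (α - s) / d) + (1 - a) * (1 / q + β / d)) * (τ * d) = a * τ / p * d + a * τ * (α - s) + (1 - a) * τ / q * d + (1 - a) * τ * β := by field_simp; ring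
    rw [e1, e2] at h1
    have e3 : (1 / τ - a * (1 / p - s) - (1 - a) / q) * τ = 1 - a * τ / p + a * s * τ - (1 - a) * τ / q := by field_simp; ring
    have e4 : (α * p + d - 1) * (a * τ / p) = α * a * τ + (d - 1) * (a * τ / p) := by field_simp; ring
    have e5 : (β * q + d - 1) * ((1 - a) * τ / q) = β * (1 - a) * τ + (d - 1) * ((1 - a) * τ / q) := by field_simp; ring
    rw [e3, e4, e5]; linarith
  obtain ⟨C, hC, h1d⟩ := ckn_1d_unb hs hp hq hτ ha ha1 hΛ hκ hsc he hPQ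
  obtain ⟨c, hc, hTG⟩ := ckn_TG (α := α) hd hs hp hΛ
  have : Nonempty (Fin d) := ⟨⟨0, by omega⟩⟩
  set κ := (volume : Measure (EuclideanSpace ℝ (Fin d))).toSphere univ with hκd
  have hκ0 : κ ≠ 0 := by
    rw [hκd, Measure.measure_univ_ne_zero]; exact Measure.toSphere_ne_zero _
  have hκt : κ ≠ ⊤ := measure_ne_top _ _
  set K : ℝ≥0∞ := (κ * ENNReal.ofReal C * (ENNReal.ofReal c)⁻¹ ^ (a * τ / p) * (κ⁻¹) ^ ((1 - a) * τ / q)) ^ (1 / τ) with hK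
  have hP0 : 0 ≤ a * τ / p := by positivity
  have hQ0 : 0 ≤ (1 - a) * τ / q := div_nonneg (mul_nonneg (by linarith) hτ0.le) hq0.le
  have hc0 : ENNReal.ofReal c ≠ 0 := by simpa using hc
  have hKt : K ≠ ⊤ := by
    refine ENNReal.rpow_ne_top_of_nonneg (by positivity) ?_
    refine ENNReal.mul_ne_top (ENNReal.mul_ne_top (ENNReal.mul_ne_top hκt ENNReal.ofReal_ne_top) ?_) ?_
    · exact ENNReal.rpow_ne_top_of_nonneg hP0 (ENNReal.inv_ne_top.2 hc0)
    · exact ENNReal.rpow_ne_top_of_nonneg hQ0 (ENNReal.inv_ne_top.2 hκ0)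
  refine ⟨K.toReal + 1, by positivity, fun u hrad hloc hcs => ?_⟩
  obtain ⟨f, R1, hf, hR1, hsupp, hae⟩ := ckn_meas hd hrad hloc hcs
  have hW : ∀ γ' τ' : ℝ, 1 ≤ τ' → weightedLnorm d γ' τ' u = (κ * ∫⁻ r in Ioi (0:ℝ), ENNReal.ofReal (r ^ (γ' * τ' + d - 1)) * ‖f r‖ₑ ^ τ') ^ (1 / τ') := by
    intro γ' τ' hτ'
    rw [weightedLnorm, hκd, ← ckn_W hd hτ' hf]
    congr 1
    refine lintegral_congr_ae ?_
    filter_upwards [hae] with x hx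
    rw [hx]
  have hTGu : truncGagliardo d s p α Λ u = (∫⁻ x : EuclideanSpace ℝ (Fin d), ∫⁻ y : EuclideanSpace ℝ (Fin d),
      ENNReal.ofReal (|f ‖x‖ - f ‖y‖| ^ p * ‖x‖ ^ (α * p) *
        chiCut Λ ‖x‖ ‖y‖ / ‖x - y‖ ^ ((d : ℝ) + s * p))) ^ (1 / p) := by
    rw [truncGagliardo]
    congr 1
    refine lintegral_congr_ae ?_
    filter_upwards [hae] with x hx
    refine lintegral_congr_ae ?_
    filter_upwards [hae] with y hy
    rw [hx, hy]
  have hTGf := hTG f hf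
  have h1f := h1d f R1 hf hR1 hsupp
  rw [hW γ τ hτ, hW β q hq, hTGu]
  clear hTGu hW hTG h1d
  generalize (∫⁻ x : EuclideanSpace ℝ (Fin d), ∫⁻ y : EuclideanSpace ℝ (Fin d),
      ENNReal.ofReal (|f ‖x‖ - f ‖y‖| ^ p * ‖x‖ ^ (α * p) *
        chiCut Λ ‖x‖ ‖y‖ / ‖x - y‖ ^ ((d : ℝ) + s * p))) = G at *
  generalize (∫⁻ r in Ioi (0:ℝ), ENNReal.ofReal (r ^ (γ * τ + d - 1)) * ‖f r‖ₑ ^ τ) = X at *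
  generalize (∫⁻ r in Ioi (0:ℝ), ENNReal.ofReal (r ^ (β * q + d - 1)) * ‖f r‖ₑ ^ q) = Y at *
  generalize (∫⁻ r in Ioi (0:ℝ), ENNReal.ofReal (r ^ (α * p + d - 1)) * cknG s p f (Icc (Λ⁻¹ * r) (Λ * r)) r) = J at *
  clear_value κ
  have hJ : J ≤ (ENNReal.ofReal c)⁻¹ * G := by
    rw [← ENNReal.mul_le_mul_iff_right hc0 ENNReal.ofReal_ne_top, ← mul_assoc, ENNReal.mul_inv_cancel hc0 ENNReal.ofReal_ne_top, one_mul]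
    exact hTGf
  have hY : Y = κ⁻¹ * (κ * Y) := by
    rw [← mul_assoc, ENNReal.inv_mul_cancel hκ0 hκt, one_mul]
  have hτi : 0 ≤ 1 / τ := by positivity
  have hX : κ * X ≤ (κ * ENNReal.ofReal C * (ENNReal.ofReal c)⁻¹ ^ (a * τ / p) * (κ⁻¹) ^ ((1 - a) * τ / q)) * (G ^ (a * τ / p) * (κ * Y) ^ ((1 - a) * τ / q)) := by
    calc κ * X ≤ κ * (ENNReal.ofReal C * (((ENNReal.ofReal c)⁻¹ * G) ^ (a * τ / p) * (κ⁻¹ * (κ * Y)) ^ ((1 - a) * τ / q))) := by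
          rw [← hY]
          refine mul_le_mul_right (h1f.trans ?_) _
          gcongr
      _ = _ := by
          rw [ENNReal.mul_rpow_of_nonneg _ _ hP0, ENNReal.mul_rpow_of_nonneg (κ⁻¹) _ hQ0]
          ring
  calc (κ * X) ^ (1 / τ) ≤ ((κ * ENNReal.ofReal C * (ENNReal.ofReal c)⁻¹ ^ (a * τ / p) * (κ⁻¹) ^ ((1 - a) * τ / q)) * (G ^ (a * τ / p) * (κ * Y) ^ ((1 - a) * τ / q))) ^ (1 / τ) :=
        ENNReal.rpow_le_rpow hX hτi
    _ = K * (G ^ (1 / p)) ^ a * ((κ * Y) ^ (1 / q)) ^ (1 - a) := by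
        rw [ENNReal.mul_rpow_of_nonneg _ _ hτi, ← hK, ENNReal.mul_rpow_of_nonneg _ _ hτi, ← mul_assoc,
          ← ENNReal.rpow_mul, ← ENNReal.rpow_mul, ← ENNReal.rpow_mul, ← ENNReal.rpow_mul]
        have e1 : a * τ / p * (1 / τ) = 1 / p * a := by field_simp
        have e2 : (1 - a) * τ / q * (1 / τ) = 1 / q * (1 - a) := by field_simp
        rw [e1, e2]
    _ ≤ _ := by
        gcongr
        rw [← ENNReal.ofReal_toReal hKt]
        refine ENNReal.ofReal_le_ofReal ?_
        rw [ENNReal.toReal_ofReal ENNReal.toReal_nonneg]; linarith
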